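/- Let f be a real polynomial in n variables (n ≥ 1, k ≥ 0) with exactly n+k+1 monomials whose exponent vectors affinely span ℝ^n, and suppose one of the monomials of f has exponent vector a = (a_1, ..., a_n) with all a_i nonzero. If the zero set X = {x ∈ ℝ^n_> : f(x) = 0} is a smooth hypersurface, then X has fewer than ((e² + 3)/4) · 2^(k(k−1)/2) · 2^n · n^k connected components. -/

import Mathlib

/-- The set of connected components of a subset `X` of `ℝ^n`, as subsets of `ℝ^n`. -/
def components {n : ℕ} (X : Set (Fin n → ℝ)) : Set (Set (Fin n → ℝ)) :=
  {C | ∃ x ∈ X, C = connectedComponentIn X x}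

section Fewnomials

open Set Filter Topology MeasureTheory

set_option linter.unusedSectionVars false

/-- The Jacobian matrix of a square system of functions. -/
noncomputable def jacobian {ι : Type*} [Fintype ι] [DecidableEq ι]
    (F : ι → (ι → ℝ) → ℝ) (w : ι → ℝ) : Matrix ι ι ℝ :=
  fun a b => fderiv ℝ (F a) w (Pi.single b 1)

/-- A zero of a square system at which the Jacobian matrix is invertible. -/
def IsNondegZero {ι : Type*} [Fintype ι] [DecidableEq ι]
    (F : ι → (ι → ℝ) → ℝ) (w : ι → ℝ) : Prop :=
  (∀ a, F a w = 0) ∧ (jacobian F w).det ≠ 0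

/-- The system `F` has at most `N` nondegenerate zeros. -/
def NondegBound {ι : Type*} [Fintype ι] [DecidableEq ι]
    (F : ι → (ι → ℝ) → ℝ) (N : ℝ) : Prop :=
  ∀ S : Finset (ι → ℝ), (∀ w ∈ S, IsNondegZero F w) → (S.card : ℝ) ≤ N

section Jacobian

variable {ι : Type*} [Fintype ι] [DecidableEq ι] {F : ι → (ι → ℝ) → ℝ}

lemma fderiv_eq_sum_single (g : (ι → ℝ) → ℝ) (w v : ι → ℝ) :
    fderiv ℝ g w v = ∑ b, fderiv ℝ g w (Pi.single b 1) * v b := by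
  conv_lhs => rw [pi_eq_sum_univ' v]
  simp [map_sum, mul_comm]

lemma jacobian_mulVec (w v : ι → ℝ) (a : ι) :
    ((jacobian F w).mulVec v) a = fderiv ℝ (F a) w v := by
  rw [fderiv_eq_sum_single]; rfl

lemma det_fderiv_pi (hF : ∀ a, Differentiable ℝ (F a)) (w : ι → ℝ) :
    (fderiv ℝ (fun w a => F a w) w).det = (jacobian F w).det := by
  rw [ContinuousLinearMap.det, ← LinearMap.det_toMatrix']
  congr 1
  ext a b
  rw [LinearMap.toMatrix'_apply]
  simp only [ContinuousLinearMap.coe_coe]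
  rw [fderiv_pi fun a => (hF a) w]
  simp [jacobian]

lemma ae_forall_det_jacobian_ne_zero (hF : ∀ a, Differentiable ℝ (F a)) :
    ∀ᵐ c : ι → ℝ, ∀ w, (∀ a, F a w = c a) → (jacobian F w).det ≠ 0 := by
  have hd : Differentiable ℝ (fun w a => F a w) := differentiable_pi.2 hF
  have := MeasureTheory.addHaar_image_eq_zero_of_det_fderivWithin_eq_zero
    (volume : Measure (ι → ℝ)) (f := fun w a => F a w)
    (f' := fun w => fderiv ℝ (fun w a => F a w) w)
    (s := {w | (jacobian F w).det = 0})
    (fun w _ => (hd w).hasFDerivAt.hasFDerivWithinAt)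
    (fun w hw => by rw [det_fderiv_pi hF]; exact hw)
  filter_upwards [measure_eq_zero_iff_ae_notMem.1 this] with c hc w hw h0
  exact hc ⟨w, h0, funext hw⟩

lemma map_nhds_eq_of_det_jacobian_ne_zero (hF : ∀ a, ContDiff ℝ 1 (F a)) {w : ι → ℝ}
    (hw : (jacobian F w).det ≠ 0) :
    map (fun w a => F a w) (𝓝 w) = 𝓝 (fun a => F a w) := by
  have hc : ContDiff ℝ 1 (fun w a => F a w) := contDiff_pi.2 hF
  have hs : HasStrictFDerivAt (fun w a => F a w) (fderiv ℝ (fun w a => F a w) w) w :=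
    hc.contDiffAt.hasStrictFDerivAt one_ne_zero
  have hdet : (fderiv ℝ (fun w a => F a w) w).det ≠ 0 := by
    rwa [det_fderiv_pi fun a => (hF a).differentiable one_ne_zero]
  exact hs.map_nhds_eq_of_equiv
    (f' := ContinuousLinearMap.toContinuousLinearEquivOfDetNeZero _ hdet)

lemma eventually_exists_perturbed_zero (hF : ∀ a, ContDiff ℝ 1 (F a)) (S : Finset (ι → ℝ))
    (hS : ∀ w ∈ S, IsNondegZero F w) (U : (ι → ℝ) → Set (ι → ℝ)) (hU : ∀ w ∈ S, U w ∈ 𝓝 w) :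
    ∀ᶠ c in 𝓝 (0 : ι → ℝ), ∀ w ∈ S, ∃ z ∈ U w, ∀ a, F a z = c a := by
  rw [Filter.eventually_all_finset]
  intro w hw
  have h0 : (fun a => F a w) = 0 := funext (hS w hw).1
  have := map_nhds_eq_of_det_jacobian_ne_zero hF (hS w hw).2
  rw [h0] at this
  rw [← this]
  filter_upwards [image_mem_map (hU w hw)]
  rintro c ⟨z, hz, rfl⟩
  exact ⟨z, hz, fun a => rfl⟩

lemma continuous_det_jacobian (hF : ∀ a, ContDiff ℝ 1 (F a)) :
    Continuous fun w => (jacobian F w).det := by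
  refine Continuous.matrix_det (continuous_matrix fun a b => ?_)
  exact ((hF a).continuous_fderiv one_ne_zero).clm_apply continuous_const

/-- The points of a finite set have disjoint neighbourhoods. -/
lemma Finset.exists_disjoint_nhds {X : Type*} [TopologicalSpace X] [T2Space X] (S : Finset X) :
    ∃ U : X → Set X, (∀ x, U x ∈ 𝓝 x) ∧ ∀ x ∈ S, ∀ y ∈ S, x ≠ y → Disjoint (U x) (U y) := by
  obtain ⟨U, hU, hd⟩ := S.finite_toSet.t2_separation
  exact ⟨U, fun x => (hU x).2.mem_nhds (hU x).1, fun x hx y hy h => hd hx hy h⟩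

end Jacobian

section Bezout

variable {ι : Type*} [Fintype ι] [DecidableEq ι]

lemma MvPolynomial.contDiff_eval (p : MvPolynomial ι ℝ) {m : WithTop ℕ∞} :
    ContDiff ℝ m fun w : ι → ℝ => eval w p := by
  induction p using MvPolynomial.induction_on with
  | C a => simpa using contDiff_const
  | add p q hp hq => simpa using hp.add hq
  | mul_X p i hp => simpa using hp.mul (contDiff_apply ℝ ℝ i)

lemma MvPolynomial.hasFDerivAt_eval (p : MvPolynomial ι ℝ) (w : ι → ℝ) :
    HasFDerivAt (fun w : ι → ℝ => eval w p)
      (∑ b, eval w (pderiv b p) • ContinuousLinearMap.proj (R := ℝ) (φ := fun _ : ι => ℝ) b) w := by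
  induction p using MvPolynomial.induction_on with
  | C a => simpa using hasFDerivAt_const a w
  | add p q hp hq =>
    simp only [map_add, add_smul, Finset.sum_add_distrib]
    exact hp.add hq
  | mul_X p i hp =>
    have h := hp.mul (hasFDerivAt_apply (𝕜 := ℝ) i w)
    simp only [eval_mul, eval_X]
    refine h.congr_fderiv ?_
    ext v
    simp only [add_apply, smul_apply, pderiv_mul, map_add,
      map_mul, eval_X, pderiv_X, ContinuousLinearMap.proj_apply, sum_apply,
      smul_eq_mul, add_mul, Finset.sum_add_distrib, Finset.mul_sum]
    rw [add_comm]
    congr 1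
    · exact Finset.sum_congr rfl fun _ _ => by ring
    · rw [Finset.sum_eq_single i (fun b _ hb => by simp [hb.symm]) (by simp)]
      simp

lemma fderiv_eval_single (p : MvPolynomial ι ℝ) (w : ι → ℝ) (b : ι) :
    fderiv ℝ (fun w : ι → ℝ => MvPolynomial.eval w p) w (Pi.single b 1)
      = MvPolynomial.eval w (MvPolynomial.pderiv b p) := by
  rw [(p.hasFDerivAt_eval w).fderiv]
  simp [Pi.single_apply]

/-- A linear form separating the points of a finite set. -/
lemma exists_separating_linear_form (S : Finset (ι → ℝ)) :
    ∃ u : ι → ℝ, Set.InjOn (fun w => ∑ b, u b * w b) (S : Set (ι → ℝ)) := by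
  obtain ⟨f, hf⟩ := Module.exists_dual_forall_apply_ne_zero (K := ℝ)
    (fun x : {p : S × S // p.1 ≠ p.2} => (x.1.1 : ι → ℝ) - x.1.2)
    (fun x h => x.2 (Subtype.ext (sub_eq_zero.1 h)))
  refine ⟨fun b => f (Pi.single b 1), fun x hx y hy hxy => ?_⟩
  have key : ∀ w, f w = ∑ b, f (Pi.single b 1) * w b := fun w => by
    conv_lhs => rw [pi_eq_sum_univ' w]
    simp [map_sum, mul_comm]
  by_contra hne
  refine hf ⟨(⟨x, hx⟩, ⟨y, hy⟩), fun h => hne (congrArg Subtype.val h)⟩ ?_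
  rw [map_sub, sub_eq_zero, key, key y]
  exact hxy

/-- The exponent vectors of weighted degree at most `L`. -/
def weightedBox (d : ι → ℕ) (L : ℕ) : Finset (ι → ℕ) :=
  {γ ∈ Fintype.piFinset fun _ : ι => Finset.range (L + 1) | ∑ a, d a * γ a ≤ L}

lemma mem_weightedBox {d : ι → ℕ} (hd : ∀ a, 0 < d a) {L : ℕ} {γ : ι → ℕ} :
    γ ∈ weightedBox d L ↔ ∑ a, d a * γ a ≤ L := by
  simp only [weightedBox, Finset.mem_filter, Fintype.mem_piFinset, Finset.mem_range,
    and_iff_right_iff_imp]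
  intro h a
  have : d a * γ a ≤ ∑ a, d a * γ a :=
    Finset.single_le_sum (f := fun a => d a * γ a) (fun _ _ => Nat.zero_le _) (Finset.mem_univ a)
  nlinarith [hd a, Nat.le_mul_of_pos_left (γ a) (hd a)]

lemma card_weightedBox_one_le (d : ι → ℕ) (hd : ∀ a, 0 < d a) (L : ℕ) :
    (weightedBox (fun _ : ι => 1) L).card ≤ (weightedBox d L).card * ∏ a, d a := by
  have hc : (Fintype.piFinset fun a => Finset.range (d a)).card = ∏ a, d a := by simp
  rw [← hc, ← Finset.card_product]
  refine Finset.card_le_card_of_injOn (fun γ => (fun a => γ a / d a, fun a => γ a % d a)) ?_ ?_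
  · intro γ hγ
    rw [Finset.mem_coe, mem_weightedBox (fun _ => one_pos)] at hγ
    rw [Finset.mem_coe, Finset.mem_product, mem_weightedBox hd, Fintype.mem_piFinset]
    refine ⟨(Finset.sum_le_sum fun a _ => ?_).trans hγ, fun a => ?_⟩
    · simpa using Nat.mul_div_le (γ a) (d a)
    · simpa using Nat.mod_lt _ (hd a)
  · intro γ _ γ' _ h
    simp only [Prod.mk.injEq] at h
    funext a
    rw [← Nat.div_add_mod (γ a) (d a), ← Nat.div_add_mod (γ' a) (d a), congrFun h.1 a,
      congrFun h.2 a]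

lemma exists_card_weightedBox_lt (p : ℕ) (hp : 0 < p) :
    ∃ L, (weightedBox (fun _ : ι => 1) (L + p)).card * p <
      (p + 1) * (weightedBox (fun _ : ι => 1) L).card := by
  by_contra! hcon
  set N : ℕ → ℕ := fun L => (weightedBox (fun _ : ι => 1) L).card
  have h0 : 1 ≤ N 0 := Finset.card_pos.2 ⟨0, (mem_weightedBox fun _ => one_pos).2 (by simp)⟩
  have hup : ∀ L, N L ≤ (L + 1) ^ Fintype.card ι := fun L => by
    refine (Finset.card_filter_le _ _).trans (by simp)
  have hp' : (0 : ℝ) < p := by exact_mod_cast hp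
  have hlow : ∀ i : ℕ, (1 + 1 / (p : ℝ)) ^ i ≤ N (i * p) := fun i => by
    induction i with
    | zero => simpa using h0
    | succ i ih =>
      have h := hcon (i * p)
      have h' : ((p : ℝ) + 1) * N (i * p) ≤ N (i * p + p) * p := by exact_mod_cast h
      rw [Nat.succ_mul, pow_succ]
      have : (1 + 1 / (p : ℝ)) * N (i * p) ≤ N (i * p + p) := by
        have e : (1 + 1 / (p : ℝ)) = (p + 1) / p := by field_simp
        rw [e, div_mul_eq_mul_div, div_le_iff₀ hp']
        exact h'
      refine le_trans ?_ this
      rw [mul_comm]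
      gcongr
  have hlim := tendsto_pow_const_div_const_pow_of_one_lt (Fintype.card ι)
    (r := 1 + 1 / (p : ℝ)) (by linarith [one_div_pos.2 hp'])
  have hpos : (0 : ℝ) < 1 / (p + 1) ^ Fintype.card ι := by positivity
  obtain ⟨i, hi, h1⟩ := ((hlim.eventually_lt_const hpos).and (eventually_ge_atTop 1)).exists
  have hr : (0 : ℝ) < (1 + 1 / (p : ℝ)) ^ i := by positivity
  rw [div_lt_div_iff₀ hr (by positivity), one_mul, ← mul_pow] at hi
  have h2 : (N (i * p) : ℝ) ≤ ((i * (p + 1) : ℕ) : ℝ) ^ Fintype.card ι := by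
    refine le_trans (b := (((i * p + 1) ^ Fintype.card ι : ℕ) : ℝ))
      (by exact_mod_cast hup (i * p)) ?_
    push_cast
    gcongr
    have : (1 : ℝ) ≤ i := by exact_mod_cast h1
    linarith
  push_cast at h2
  linarith [hlow i]

open MvPolynomial in
/-- A nontrivial algebraic relation of controlled degree between `P` and an affine-linear `u`. -/
lemma exists_algebraic_relation (P : ι → MvPolynomial ι ℝ) (d : ι → ℕ) (hd : ∀ a, 0 < d a)
    (hP : ∀ a, (P a).totalDegree ≤ d a) (u : MvPolynomial ι ℝ) (hu : u.totalDegree ≤ 1) :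
    ∃ Q : ℕ → MvPolynomial ι ℝ, (∃ t ∈ Finset.range (∏ a, d a + 1), Q t ≠ 0) ∧
      ∑ t ∈ Finset.range (∏ a, d a + 1), (aeval P (Q t)) * u ^ t = 0 := by
  set p := ∏ a, d a with hpdef
  have hp : 0 < p := Finset.prod_pos fun a _ => hd a
  obtain ⟨L, hL⟩ := exists_card_weightedBox_lt (ι := ι) p hp
  have hcard : (weightedBox (fun _ : ι => 1) (L + p)).card <
      (weightedBox d L).card * (p + 1) := by
    have := card_weightedBox_one_le d hd L
    rw [← hpdef] at this
    nlinarith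
  set fam := weightedBox d L ×ˢ Finset.range (p + 1)
  let T : fam → MvPolynomial ι ℝ := fun x => (∏ a, P a ^ x.1.1 a) * u ^ x.1.2
  let Φ : (fam → ℝ) →ₗ[ℝ] MvPolynomial ι ℝ := Fintype.linearCombination ℝ T
  let coeffs : MvPolynomial ι ℝ →ₗ[ℝ] (weightedBox (fun _ : ι => 1) (L + p) → ℝ) :=
    LinearMap.pi fun γ => MvPolynomial.lcoeff ℝ (Finsupp.equivFunOnFinite.symm γ.1)
  have hker : LinearMap.ker (coeffs ∘ₗ Φ) ≠ ⊥ := by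
    refine LinearMap.ker_ne_bot_of_finrank_lt ?_
    rw [Module.finrank_fintype_fun_eq_card, Module.finrank_fintype_fun_eq_card,
      Fintype.card_coe, Fintype.card_coe, Finset.card_product, Finset.card_range]
    exact hcard
  obtain ⟨q, hq, hq0⟩ := Submodule.exists_mem_ne_zero_of_ne_bot hker
  have hT : ∀ x, (T x).totalDegree ≤ L + p := fun x => by
    have hx := Finset.mem_product.1 x.2
    refine (totalDegree_mul _ _).trans (add_le_add ?_ ?_)
    · refine (totalDegree_finsetProd _ _).trans
        (le_trans (Finset.sum_le_sum fun a _ => ?_) ((mem_weightedBox hd).1 hx.1))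
      refine (totalDegree_pow _ _).trans ?_
      rw [mul_comm]
      gcongr
      exact hP a
    · refine (totalDegree_pow _ _).trans ?_
      have := Finset.mem_range.1 hx.2
      nlinarith
  have hΦdeg : (Φ q).totalDegree ≤ L + p := by
    simp only [Φ, Fintype.linearCombination_apply]
    exact totalDegree_finsetSum_le fun x _ => (totalDegree_smul_le _ _).trans (hT x)
  have hΦ : Φ q = 0 := by
    ext γ
    by_cases hγ : ∑ a, γ a ≤ L + p
    · have := congrFun (LinearMap.mem_ker.1 hq)
        ⟨γ, (mem_weightedBox fun _ => one_pos).2 (by simpa using hγ)⟩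
      simpa [coeffs] using this
    · rw [coeff_zero]
      refine coeff_eq_zero_of_totalDegree_lt (lt_of_le_of_lt hΦdeg ?_)
      rw [Finset.sum_subset (Finset.subset_univ γ.support) (by simp)]
      omega
  let q' : (ι → ℕ) × ℕ → ℝ := fun x => if h : x ∈ fam then q ⟨x, h⟩ else 0
  refine ⟨fun t => ∑ α ∈ weightedBox d L,
    monomial (Finsupp.equivFunOnFinite.symm α) (q' (α, t)), ?_, ?_⟩
  · obtain ⟨x, hx⟩ := Function.ne_iff.1 hq0
    have hx' := Finset.mem_product.1 x.2
    refine ⟨x.1.2, hx'.2, fun h => hx ?_⟩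
    have := congrArg (coeff (Finsupp.equivFunOnFinite.symm x.1.1)) h
    rw [coeff_sum] at this
    simp only [coeff_monomial, EmbeddingLike.apply_eq_iff_eq, coeff_zero] at this
    rw [Finset.sum_ite_eq' , if_pos hx'.1] at this
    simpa [q'] using this
  · rw [← hΦ]
    simp only [Φ, Fintype.linearCombination_apply, map_sum, aeval_monomial, Finset.sum_mul, T]
    rw [Finset.sum_comm, ← Finset.sum_product' (f := fun α t => (algebraMap ℝ (MvPolynomial ι ℝ))
        (q' (α, t)) * ((Finsupp.equivFunOnFinite.symm α).prod fun i k => P i ^ k) * u ^ t),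
      ← Finset.sum_coe_sort]
    refine Finset.sum_congr rfl fun x _ => ?_
    have : q' (x.1.1, x.1.2) = q x := by simp [q']
    rw [this, Finsupp.prod_fintype _ _ (by simp), Algebra.smul_def, mul_assoc]
    rfl

open MvPolynomial in
/-- Bézout's bound for the nondegenerate real zeros of a square polynomial system. -/
theorem nondegBound_eval (P : ι → MvPolynomial ι ℝ) (d : ι → ℕ)
    (hP : ∀ a, (P a).totalDegree ≤ d a) :
    NondegBound (fun a w => eval w (P a)) (∏ a, d a : ℕ) := by
  intro S hS
  rw [Nat.cast_le]
  by_cases hd : ∀ a, 0 < d a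
  swap
  · push Not at hd
    obtain ⟨a, ha⟩ := hd
    rcases S.eq_empty_or_nonempty with rfl | ⟨w, hw⟩
    · simp
    refine absurd (Matrix.det_eq_zero_of_row_eq_zero a fun b => ?_) (hS w hw).2
    have h0 := totalDegree_eq_zero_iff_eq_C.1 (Nat.le_zero.1 ((hP a).trans ha))
    rw [jacobian, fderiv_eval_single, h0]
    simp
  obtain ⟨u, hu⟩ := exists_separating_linear_form S
  set U : MvPolynomial ι ℝ := ∑ b, C (u b) * X b
  have hUe : ∀ w, eval w U = ∑ b, u b * w b := fun w => by simp [U]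
  have hUd : U.totalDegree ≤ 1 := totalDegree_finsetSum_le fun b _ =>
    (totalDegree_mul _ _).trans (by simp [totalDegree_C, totalDegree_X])
  obtain ⟨Q, ⟨t, ht, hQt⟩, hQ⟩ := exists_algebraic_relation P d hd hP U hUd
  obtain ⟨V, hV, hVd⟩ := (S.image fun w => eval w U).exists_disjoint_nhds
  have hcont : ∀ a, ContDiff ℝ 1 fun w => eval w (P a) := fun a => (P a).contDiff_eval
  have hev := eventually_exists_perturbed_zero hcont S hS
    (fun w => (fun z => eval z U) ⁻¹' V (eval w U))
    fun w _ => (U.contDiff_eval (m := 0)).continuous.continuousAt.preimage_mem_nhds (hV _)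
  obtain ⟨ε, hε, hball⟩ := Metric.eventually_nhds_iff_ball.1 hev
  obtain ⟨c, hc, hQc⟩ : ∃ c : ι → ℝ, c ∈ Metric.ball 0 ε ∧ eval c (Q t) ≠ 0 := by
    by_contra! hcon
    refine hQt (funext_set (fun _ => Metric.ball 0 ε) (fun _ => ?_) fun x hx => ?_)
    · rw [Real.ball_eq_Ioo]; exact Set.Ioo_infinite (by linarith)
    · rw [map_zero]
      refine hcon x ?_
      rw [ball_pi _ hε]
      simpa using hx
  choose! z hzU hz using hball c hc
  let R : Polynomial ℝ :=
    ∑ s ∈ Finset.range (∏ a, d a + 1), Polynomial.C (eval c (Q s)) * Polynomial.X ^ s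
  have hR0 : R ≠ 0 := fun h => hQc (by
    have := congrArg (fun r => r.coeff t) h
    simpa [R, Polynomial.finsetSum_coeff, Polynomial.coeff_X_pow, Finset.mem_range.1 ht] using this)
  have hRdeg : R.natDegree ≤ ∏ a, d a := Polynomial.natDegree_sum_le_of_forall_le _ _ fun s hs =>
    (Polynomial.natDegree_C_mul_X_pow_le _ _).trans (Nat.lt_succ_iff.1 (Finset.mem_range.1 hs))
  have hroot : ∀ w ∈ S, R.IsRoot (eval (z w) U) := fun w hw => by
    have h := congrArg (eval (z w)) hQ
    have hPz : (fun a => eval (z w) (P a)) = c := funext (hz w hw)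
    have hae : ∀ q : MvPolynomial ι ℝ, eval (z w) (aeval P q) = eval c q := fun q => by
      rw [← hPz]
      induction q using MvPolynomial.induction_on with
      | C a => simp
      | add p q hp hq => rw [map_add, map_add, hp, hq, map_add]
      | mul_X p i hp => rw [map_mul, map_mul, hp, aeval_X, map_mul, eval_X]
    simp only [map_sum, map_mul, map_pow, hae, map_zero] at h
    simpa [R, Polynomial.eval_finsetSum] using h
  have hinj : Set.InjOn (fun w => eval (z w) U) (S : Set (ι → ℝ)) := fun w hw w' hw' h => by
    by_contra hne
    have hne' : eval w U ≠ eval w' U := fun h' => hne (hu hw hw' (by simpa [hUe] using h'))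
    refine Set.disjoint_left.1 (hVd _ (Finset.mem_image_of_mem _ hw) _
      (Finset.mem_image_of_mem _ hw') hne') (hzU w hw) ?_
    have := hzU w' hw'
    simp only [mem_preimage] at this h
    rwa [← h] at this
  calc S.card = (S.image fun w => eval (z w) U).card := (Finset.card_image_of_injOn hinj).symm
    _ ≤ R.roots.toFinset.card := Finset.card_le_card fun x hx => by
        obtain ⟨w, hw, rfl⟩ := Finset.mem_image.1 hx
        simpa [hR0] using hroot w hw
    _ ≤ R.roots.card := Multiset.toFinset_card_le _
    _ ≤ R.natDegree := R.card_roots'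
    _ ≤ _ := hRdeg

end Bezout

section Flow

variable {E : Type*} [NormedAddCommGroup E] [NormedSpace ℝ E] [CompleteSpace E]

/-- A bounded, globally Lipschitz vector field has global integral curves. -/
lemma exists_global_integralCurve {X : E → E} {K M : NNReal} (hX : LipschitzWith K X)
    (hM : ∀ x, ‖X x‖ ≤ M) (x₀ : E) :
    ∃ γ : ℝ → E, γ 0 = x₀ ∧ ∀ t, HasDerivAt γ (X (γ t)) t := by
  have hloc : ∀ N : ℕ, ∃ α : ℝ → E, α 0 = x₀ ∧
      ∀ t ∈ Ioo (-(N + 1 : ℝ)) (N + 1), HasDerivAt α (X (α t)) t := fun N => by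
    have h0 : (0 : ℝ) ∈ Icc (-(N + 1 : ℝ)) (N + 1) :=
      ⟨by linarith [N.cast_nonneg (α := ℝ)], by positivity⟩
    have hpl : IsPicardLindelof (fun _ : ℝ => X) (tmin := -(N + 1 : ℝ)) (tmax := N + 1) ⟨0, h0⟩ x₀
        (M * (N + 1)) 0 M K := by
      refine IsPicardLindelof.of_time_independent (fun x _ => hM x) hX.lipschitzOnWith ?_
      simp
    obtain ⟨α, h1, h2⟩ := hpl.exists_eq_forall_mem_Icc_hasDerivWithinAt₀
    exact ⟨α, h1, fun t ht => (h2 t (Ioo_subset_Icc_self ht)).hasDerivAt (Icc_mem_nhds ht.1 ht.2)⟩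
  choose α hα0 hα using hloc
  have huniq : ∀ M N : ℕ, M ≤ N → ∀ t ∈ Ioo (-(M + 1 : ℝ)) (M + 1), α M t = α N t := by
    intro M N hMN
    have hMN' : (M : ℝ) ≤ N := by exact_mod_cast hMN
    refine ODE_solution_unique_of_mem_Ioo (K := K) (v := fun _ => X) (s := fun _ => univ) (t₀ := 0)
      (fun _ _ => hX.lipschitzOnWith) ⟨by linarith [M.cast_nonneg (α := ℝ)], by positivity⟩
      (fun t ht => ⟨hα M t ht, trivial⟩)
      (fun t ht => ⟨hα N t ⟨by linarith [ht.1], by linarith [ht.2]⟩, trivial⟩) ?_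
    rw [hα0, hα0]
  have hceil : ∀ t : ℝ, t ∈ Ioo (-((⌈|t|⌉₊ : ℕ) + 1 : ℝ)) ((⌈|t|⌉₊ : ℕ) + 1) := fun t => by
    have := Nat.le_ceil |t|
    have h := abs_le.1 this
    exact ⟨by linarith [h.1], by linarith [h.2]⟩
  have hglue : ∀ N : ℕ, ∀ t ∈ Ioo (-(N + 1 : ℝ)) (N + 1), α ⌈|t|⌉₊ t = α N t := fun N t ht => by
    rcases le_total ⌈|t|⌉₊ N with h | h
    · exact huniq _ _ h t (hceil t)
    · exact (huniq _ _ h t ht).symm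
  refine ⟨fun t => α ⌈|t|⌉₊ t, by simpa using hα0 0, fun t => ?_⟩
  refine (hα ⌈|t|⌉₊ t (hceil t)).congr_of_eventuallyEq ?_
  filter_upwards [Ioo_mem_nhds (hceil t).1 (hceil t).2] with s hs
  exact hglue _ s hs

lemma integralCurve_unique {X : E → E} {K : NNReal} (hX : LipschitzWith K X) {γ₁ γ₂ : ℝ → E}
    (h₁ : ∀ t, HasDerivAt γ₁ (X (γ₁ t)) t) (h₂ : ∀ t, HasDerivAt γ₂ (X (γ₂ t)) t) {t₁ t₂ : ℝ}
    (h : γ₁ t₁ = γ₂ t₂) (s : ℝ) : γ₁ (t₁ + s) = γ₂ (t₂ + s) := by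
  have := ODE_solution_unique_univ (K := K) (v := fun _ => X) (s := fun _ => univ) (t₀ := 0)
    (f := fun s => γ₁ (t₁ + s)) (g := fun s => γ₂ (t₂ + s)) (fun _ => hX.lipschitzOnWith)
    (fun s => ⟨by simpa using (h₁ (t₁ + s)).comp_const_add t₁ s, trivial⟩)
    (fun s => ⟨by simpa using (h₂ (t₂ + s)).comp_const_add t₂ s, trivial⟩) (by simpa using h)
  exact congrFun this s

end Flow

section VectorField

variable {ι : Type*} [Fintype ι] [DecidableEq ι] {G : ι → (ι → ℝ) → ℝ} {r : ι}

/-- The vector field tangent to the curves on which all `G a`, `a ≠ r`, are constant. -/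
noncomputable def tangentField (G : ι → (ι → ℝ) → ℝ) (r : ι) (w : ι → ℝ) : ι → ℝ :=
  fun b => (jacobian G w).adjugate b r

lemma jacobian_update (κ : (ι → ℝ) → ℝ) (w : ι → ℝ) :
    jacobian (Function.update G r κ) w =
      (jacobian G w).updateRow r fun b => fderiv ℝ κ w (Pi.single b 1) := by
  ext a b
  rcases eq_or_ne a r with rfl | h
  · simp [jacobian]
  · simp [jacobian, Matrix.updateRow_ne h, Function.update_of_ne h]

lemma fderiv_tangentField (κ : (ι → ℝ) → ℝ) (w : ι → ℝ) :
    fderiv ℝ κ w (tangentField G r w) = (jacobian (Function.update G r κ) w).det := by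
  rw [fderiv_eq_sum_single, Matrix.det_eq_sum_mul_adjugate_row _ r, jacobian_update]
  refine Finset.sum_congr rfl fun b _ => ?_
  rw [Matrix.updateRow_self, tangentField, Matrix.adjugate_apply, Matrix.adjugate_apply,
    Matrix.updateRow_idem]

lemma fderiv_tangentField_of_ne {a : ι} (ha : a ≠ r) (w : ι → ℝ) :
    fderiv ℝ (G a) w (tangentField G r w) = 0 := by
  rw [fderiv_tangentField]
  refine Matrix.det_zero_of_row_eq ha ?_
  funext b
  simp [jacobian, Function.update_of_ne ha]

lemma contDiff_jacobian_entry (hG : ∀ a, ContDiff ℝ (⊤ : ℕ∞) (G a)) (a b : ι) :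
    ContDiff ℝ (⊤ : ℕ∞) fun w => jacobian G w a b :=
  ((hG a).fderiv_right (m := (⊤ : ℕ∞)) (by simp)).clm_apply contDiff_const

lemma contDiff_det {A : (ι → ℝ) → Matrix ι ι ℝ} {m : WithTop ℕ∞}
    (hA : ∀ a b, ContDiff ℝ m fun w => A w a b) : ContDiff ℝ m fun w => (A w).det := by
  simp only [Matrix.det_apply']
  exact ContDiff.sum fun σ _ => contDiff_const.mul (contDiff_prod fun i _ => hA _ _)

lemma contDiff_tangentField (hG : ∀ a, ContDiff ℝ (⊤ : ℕ∞) (G a)) :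
    ContDiff ℝ (⊤ : ℕ∞) (tangentField G r) := by
  refine contDiff_pi.2 fun b => ?_
  simp only [tangentField, Matrix.adjugate_apply]
  refine contDiff_det fun a c => ?_
  rcases eq_or_ne a r with rfl | h
  · simpa using contDiff_const
  · simpa [Matrix.updateRow_ne h] using contDiff_jacobian_entry hG a c

end VectorField

section Rolle

variable {ι β : Type*} [Fintype ι] [DecidableEq ι] [Finite β] {G : ι → (ι → ℝ) → ℝ} {r : ι}
  {q : β → (ι → ℝ) → ℝ} {t s σ : ℝ} {φ : (ι → ℝ) → ℝ} {γ : ℝ → ι → ℝ}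

lemma hasDerivAt_comp_curve {κ : (ι → ℝ) → ℝ} (hκ : Differentiable ℝ κ)
    (hγ : ∀ u, HasDerivAt γ (φ (γ u) • tangentField G r (γ u)) u) (s u : ℝ) :
    HasDerivAt (fun u => κ (γ (s * u)))
      (s * (φ (γ (s * u)) * (jacobian (Function.update G r κ) (γ (s * u))).det)) u := by
  have h1 : HasDerivAt (fun u => s * u) s u := by simpa using (hasDerivAt_id u).const_mul s
  have h2 := (hγ (s * u)).scomp u h1
  have h3 := (hκ (γ (s * u))).hasFDerivAt.comp_hasDerivAt u h2
  rw [map_smul, map_smul, fderiv_tangentField] at h3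
  exact h3

lemma curve_mem_fiber (hG : ∀ a, Differentiable ℝ (G a))
    (hγ : ∀ u, HasDerivAt γ (φ (γ u) • tangentField G r (γ u)) u)
    (h0 : ∀ a ≠ r, G a (γ 0) = 0) (u : ℝ) : ∀ a ≠ r, G a (γ u) = 0 := by
  intro a ha
  have hd : ∀ v, HasDerivAt (fun v => G a (γ v)) 0 v := fun v => by
    have h := hasDerivAt_comp_curve (hG a) hγ 1 v
    simp only [one_mul] at h
    rwa [← fderiv_tangentField, fderiv_tangentField_of_ne ha, mul_zero] at h
  have := is_const_of_deriv_eq_zero (fun v => (hd v).differentiableAt) (fun v => (hd v).deriv) u 0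
  exact this.trans (h0 a ha)

lemma curve_growth (hG : ∀ a, Differentiable ℝ (G a))
    (hγ : ∀ u, HasDerivAt γ (φ (γ u) • tangentField G r (γ u)) u) (hs : s * s = 1) {T : ℝ}
    (hT : ∀ u ∈ Icc 0 T, φ (γ (s * u)) = 1 ∧ t ≤ σ * (jacobian G (γ (s * u))).det)
    {u : ℝ} (hu : u ∈ Icc 0 T) :
    s * σ * G r (γ 0) + t * u ≤ s * σ * G r (γ (s * u)) := by
  have hd : ∀ v, HasDerivAt (fun v => s * σ * G r (γ (s * v)) - t * v)
      (s * σ * (s * (φ (γ (s * v)) * (jacobian G (γ (s * v))).det)) - t) v := fun v => by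
    have h := hasDerivAt_comp_curve (hG r) hγ s v
    rw [Function.update_eq_self] at h
    exact (h.const_mul (s * σ)).sub (by simpa using (hasDerivAt_id v).const_mul t)
  have hmono : MonotoneOn (fun v => s * σ * G r (γ (s * v)) - t * v) (Icc 0 T) := by
    refine monotoneOn_of_deriv_nonneg (convex_Icc _ _)
      (fun v _ => (hd v).continuousAt.continuousWithinAt)
      (fun v _ => (hd v).differentiableAt.differentiableWithinAt) fun v hv => ?_
    rw [(hd v).deriv]
    obtain ⟨h1, h2⟩ := hT v (interior_subset hv)
    rw [h1]
    have : s * σ * (s * (1 * (jacobian G (γ (s * v))).det)) =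
      (s * s) * (σ * (jacobian G (γ (s * v))).det) := by ring
    rw [this, hs]
    linarith
  have := hmono ⟨le_rfl, hu.1.trans hu.2⟩ hu hu.1
  simp only [mul_zero, sub_zero] at this
  linarith

lemma exists_event (hG : ∀ a, ContDiff ℝ (⊤ : ℕ∞) (G a)) (hq : ∀ i, Continuous (q i))
    (hbdd : Bornology.IsBounded {w | (∀ a ≠ r, G a w = 0) ∧ ∀ i, t ≤ q i w})
    (hφ : ∀ w, (∀ a ≠ r, G a w = 0) → (∀ i, t ≤ q i w) → φ w = 1) (ht : 0 < t)
    (hγ : ∀ u, HasDerivAt γ (φ (γ u) • tangentField G r (γ u)) u) (hs : s * s = 1)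
    (h0 : ∀ a ≠ r, G a (γ 0) = 0) (hJ0 : t < σ * (jacobian G (γ 0)).det)
    (hq0 : ∀ i, t < q i (γ 0)) :
    ∃ τ, 0 ≤ τ ∧ (σ * (jacobian G (γ (s * τ))).det = t ∨ ∃ i, q i (γ (s * τ)) = t) ∧
      ∀ u ∈ Icc 0 τ, (∀ i, t ≤ q i (γ (s * u))) ∧ t ≤ σ * (jacobian G (γ (s * u))).det := by
  have hGd : ∀ a, Differentiable ℝ (G a) := fun a => (hG a).differentiable (by simp)
  have hγc : Continuous γ := continuous_iff_continuousAt.2 fun u => (hγ u).continuousAt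
  let κ : Option β → ℝ → ℝ := fun e => e.elim (fun u => σ * (jacobian G (γ (s * u))).det)
    fun i u => q i (γ (s * u))
  have hpath : Continuous fun u => γ (s * u) := hγc.comp (by fun_prop)
  have hκc : ∀ e, Continuous (κ e) := by
    rintro (_ | i)
    · exact continuous_const.mul
        ((continuous_det_jacobian fun a => (hG a).of_le (by simp)).comp hpath)
    · exact (hq i).comp hpath
  have hκ0 : ∀ e, t < κ e 0 := by
    rintro (_ | i)
    · simpa [κ] using hJ0
    · simpa [κ] using hq0 i
  have hfib := fun u => curve_mem_fiber hGd hγ h0 (s * u)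
  set B : Set ℝ := Ici 0 ∩ ⋃ e, {u | κ e u ≤ t} with hB
  have hBc : IsClosed B :=
    isClosed_Ici.inter (isClosed_iUnion_of_finite fun e => isClosed_le (hκc e) continuous_const)
  have hBne : B.Nonempty := by
    by_contra hne
    have hall : ∀ u, 0 ≤ u → ∀ e, t < κ e u := fun u hu e => by
      by_contra! hle
      exact hne ⟨u, hu, mem_iUnion.2 ⟨e, hle⟩⟩
    have hT : ∀ T, ∀ u ∈ Icc 0 T, φ (γ (s * u)) = 1 ∧ t ≤ σ * (jacobian G (γ (s * u))).det :=
      fun T u hu => ⟨hφ _ (hfib u) fun i => (hall u hu.1 (some i)).le, (hall u hu.1 none).le⟩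
    obtain ⟨R, hR⟩ := hbdd.subset_closedBall 0
    obtain ⟨C, hC⟩ := (isCompact_closedBall (0 : ι → ℝ) R).exists_bound_of_continuousOn
      (f := fun w => s * σ * G r w) (continuousOn_const.mul (hGd r).continuous.continuousOn)
    have hmem : ∀ u, 0 ≤ u → γ (s * u) ∈ Metric.closedBall (0 : ι → ℝ) R := fun u hu =>
      hR ⟨hfib u, fun i => (hall u hu (some i)).le⟩
    have hC0 := hC _ (hmem 0 le_rfl)
    have hCnn : 0 ≤ C := (norm_nonneg _).trans hC0
    have hu : (0 : ℝ) ≤ (2 * C + 1) / t := by positivity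
    have hg := curve_growth hGd hγ hs (hT _) (right_mem_Icc.2 hu)
    have hCu := hC _ (hmem _ hu)
    rw [mul_div_cancel₀ _ ht.ne'] at hg
    simp only [mul_zero] at hC0
    have h1 := abs_le.1 hC0
    have h2 := abs_le.1 hCu
    linarith [h1.1, h2.2]
  have hBb : BddBelow B := ⟨0, fun u hu => hu.1⟩
  have hτ := hBc.csInf_mem hBne hBb
  set τ := sInf B
  obtain ⟨e, he⟩ := mem_iUnion.1 hτ.2
  have hτ0 : 0 < τ := lt_of_le_of_ne hτ.1 fun h => by
    rw [← h] at he
    exact absurd he (not_le.2 (hκ0 e))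
  have hlt : ∀ u ∈ Ico 0 τ, ∀ e, t ≤ κ e u := fun u hu e => by
    by_contra! hle
    exact notMem_of_lt_csInf hu.2 hBb ⟨hu.1, mem_iUnion.2 ⟨e, hle.le⟩⟩
  have hle : ∀ u ∈ Icc 0 τ, ∀ e, t ≤ κ e u := fun u hu e => by
    rw [← closure_Ico hτ0.ne] at hu
    exact closure_minimal (s := Ico 0 τ) (t := {u | t ≤ κ e u}) (fun u hu => hlt u hu e)
      (isClosed_le continuous_const (hκc e)) hu
  refine ⟨τ, hτ0.le, ?_, fun u hu => ⟨fun i => hle u hu (some i), hle u hu none⟩⟩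
  have heq := le_antisymm he (hle τ ⟨hτ0.le, le_rfl⟩ e)
  rcases e with _ | i
  · exact Or.inl heq
  · exact Or.inr ⟨i, heq⟩

end Rolle

section Rolle

variable {ι β : Type*} [Fintype ι] [DecidableEq ι] [Fintype β] {G : ι → (ι → ℝ) → ℝ} {r : ι}
  {q : β → (ι → ℝ) → ℝ} {t : ℝ}

/-- The sign attached to a Boolean. -/
def boolSign (b : Bool) : ℝ := if b then 1 else -1

lemma boolSign_mul_self (b : Bool) : boolSign b * boolSign b = 1 := by
  cases b <;> simp [boolSign]

lemma exists_boolSign_mul (x : ℝ) : ∃ b, boolSign b * x = |x| := by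
  rcases le_total 0 x with h | h
  · exact ⟨true, by simp [boolSign, abs_of_nonneg h]⟩
  · exact ⟨false, by simp [boolSign, abs_of_nonpos h]⟩

/-- The events that end the motion along the curve: `±J` or one of the functions `q i` reaches
a small value. -/
noncomputable def rolleEvent (G : ι → (ι → ℝ) → ℝ) (q : β → (ι → ℝ) → ℝ) :
    Bool ⊕ β → (ι → ℝ) → ℝ :=
  Sum.elim (fun b w => boolSign b * (jacobian G w).det) q

lemma HasDerivAt.nonpos_of_left_min {f : ℝ → ℝ} {d τ : ℝ} (hf : HasDerivAt f d τ) (hτ : 0 < τ)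
    (hmin : ∀ u ∈ Icc 0 τ, f τ ≤ f u) : d ≤ 0 := by
  have h := (hasDerivWithinAt_iff_tendsto_slope' (s := Iio τ) (by simp)).1 hf.hasDerivWithinAt
  refine le_of_tendsto h ?_
  filter_upwards [Ioo_mem_nhdsLT hτ] with u hu
  rw [slope_def_field]
  exact div_nonpos_of_nonneg_of_nonpos
    (by linarith [hmin u ⟨hu.1.le, hu.2.le⟩]) (by linarith [hu.2])

lemma card_le_sum_fibers {α E' : Type*} [DecidableEq α] [DecidableEq E'] [Fintype α]
    (T : Finset (α × E')) (B : α → ℝ)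
    (hB : ∀ e, (((T.filter fun x => x.1 = e).image Prod.snd).card : ℝ) ≤ B e) :
    (T.card : ℝ) ≤ ∑ e, B e := by
  rw [Finset.card_eq_sum_card_fiberwise (f := Prod.fst) (t := Finset.univ) (by simp)]
  push_cast
  refine Finset.sum_le_sum fun e _ => le_trans (le_of_eq ?_) (hB e)
  rw [Finset.card_image_of_injOn]
  rintro ⟨x, y⟩ hx ⟨x', y'⟩ hx' h
  simp only [Finset.coe_filter, mem_ofPred_eq] at hx hx' h
  rw [hx.2, hx'.2, h]

theorem two_mul_card_le_of_regular (hG : ∀ a, ContDiff ℝ (⊤ : ℕ∞) (G a))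
    (hq : ∀ i, ContDiff ℝ (⊤ : ℕ∞) (q i)) (ht : 0 < t)
    (hbdd : Bornology.IsBounded {w | (∀ a ≠ r, G a w = 0) ∧ ∀ i, t ≤ q i w})
    (hreg : ∀ e w, (∀ a ≠ r, G a w = 0) → rolleEvent G q e w = t →
      (jacobian (Function.update G r (rolleEvent G q e)) w).det ≠ 0)
    (S : Finset (ι → ℝ)) (hS : ∀ z ∈ S, ∀ a, G a z = 0) (hSJ : ∀ z ∈ S, t < |(jacobian G z).det|)
    (hSq : ∀ z ∈ S, ∀ i, t < q i z) (B : Bool ⊕ β → ℝ)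
    (hB : ∀ e, ∀ T : Finset (ι → ℝ),
      (∀ w ∈ T, (∀ a ≠ r, G a w = 0) ∧ rolleEvent G q e w = t) → (T.card : ℝ) ≤ B e) :
    2 * (S.card : ℝ) ≤ ∑ e, B e := by
  classical
  obtain ⟨R, hR⟩ := hbdd.subset_closedBall 0
  let bump : ContDiffBump (0 : ι → ℝ) := ⟨max R 1, max R 1 + 1, by positivity, by linarith⟩
  set φ : (ι → ℝ) → ℝ := fun w => bump w
  have hφ : ∀ w, (∀ a ≠ r, G a w = 0) → (∀ i, t ≤ q i w) → φ w = 1 := fun w h1 h2 =>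
    bump.one_of_mem_closedBall (Metric.closedBall_subset_closedBall (le_max_left _ _) (hR ⟨h1, h2⟩))
  set X : (ι → ℝ) → ι → ℝ := fun w => φ w • tangentField G r w with hXdef
  have hXs : ContDiff ℝ (⊤ : ℕ∞) X := bump.contDiff.smul (contDiff_tangentField hG)
  have hXc : HasCompactSupport X := bump.hasCompactSupport.smul_right
  obtain ⟨L, hL⟩ := hXs.lipschitzWith_of_hasCompactSupport hXc (by simp)
  obtain ⟨M, hM⟩ := hXs.continuous.bounded_above_of_compact_support hXc
  have hM0 : 0 ≤ M := (norm_nonneg _).trans (hM 0)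
  choose γ hγ0 hγ using fun z => exists_global_integralCurve (M := ⟨M, hM0⟩) hL hM z
  choose σ hσ using fun z : ι → ℝ => exists_boolSign_mul (jacobian G z).det
  have hev : ∀ z ∈ S, ∀ b, ∃ τ e, 0 < τ ∧ rolleEvent G q e (γ z (boolSign b * τ)) = t ∧
      ∀ u ∈ Icc 0 τ, (∀ i, t ≤ q i (γ z (boolSign b * u))) ∧
        t ≤ boolSign (σ z) * (jacobian G (γ z (boolSign b * u))).det ∧
        t ≤ rolleEvent G q e (γ z (boolSign b * u)) := by
    intro z hz b
    have hJz : t < boolSign (σ z) * (jacobian G z).det := by rw [hσ]; exact hSJ z hz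
    obtain ⟨τ, hτ, he, hle⟩ := exists_event hG (fun i => (hq i).continuous) hbdd hφ ht (hγ z)
      (boolSign_mul_self b) (σ := boolSign (σ z)) (by rw [hγ0]; exact fun a _ => hS z hz a)
      (by rwa [hγ0]) (by rw [hγ0]; exact hSq z hz)
    have hpos : ∀ {x : ℝ}, (x = t → 0 = τ → False) → x = t → 0 < τ := fun h hx =>
      lt_of_le_of_ne hτ (h hx)
    rcases he with he | ⟨i, he⟩
    · refine ⟨τ, Sum.inl (σ z), hpos (fun h h0 => ?_) he, he, fun u hu =>
        ⟨(hle u hu).1, (hle u hu).2, (hle u hu).2⟩⟩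
      rw [← h0, mul_zero, hγ0] at h
      linarith
    · refine ⟨τ, Sum.inr i, hpos (fun h h0 => ?_) he, he, fun u hu =>
        ⟨(hle u hu).1, (hle u hu).2, (hle u hu).1 i⟩⟩
      rw [← h0, mul_zero, hγ0] at h
      linarith [hSq z hz i]
  choose! τ e hτ he hle using hev
  have hGd : ∀ a, Differentiable ℝ (G a) := fun a => (hG a).differentiable (by simp)
  have hfib : ∀ z ∈ S, ∀ u, ∀ a ≠ r, G a (γ z u) = 0 := fun z hz =>
    curve_mem_fiber hGd (hγ z) (by rw [hγ0]; exact fun a _ => hS z hz a)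
  have hκd : ∀ e, Differentiable ℝ (rolleEvent G q e) := by
    rintro (b | i)
    · exact ((contDiff_det (contDiff_jacobian_entry hG)).differentiable (by simp)).const_mul _
    · exact (hq i).differentiable (by simp)
  have hsame : ∀ z₁ ∈ S, ∀ z₂ ∈ S, ∀ b,
      γ z₁ (boolSign b * τ z₁ b) = γ z₂ (boolSign b * τ z₂ b) → τ z₁ b ≤ τ z₂ b → z₁ = z₂ := by
    intro z₁ h₁ z₂ h₂ b h hττ
    have hu := integralCurve_unique hL (hγ z₁) (hγ z₂) h (-(boolSign b * τ z₁ b))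
    rw [add_neg_cancel, hγ0, ← sub_eq_add_neg, ← mul_sub] at hu
    have hg := curve_growth hGd (hγ z₂) (boolSign_mul_self b) (σ := boolSign (σ z₂)) (t := t)
      (T := τ z₂ b) (fun u hu => ⟨hφ _ (hfib z₂ h₂ _) (hle z₂ h₂ b u hu).1, (hle z₂ h₂ b u hu).2.1⟩)
      (u := τ z₂ b - τ z₁ b) ⟨by linarith, by linarith [hτ z₁ h₁ b]⟩
    rw [← hu, hγ0, hS z₁ h₁ r, hS z₂ h₂ r] at hg
    have : τ z₂ b - τ z₁ b = 0 := by nlinarith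
    rw [this, mul_zero, hγ0] at hu
    exact hu
  have hopp : ∀ z₁ ∈ S, ∀ z₂ ∈ S, e z₁ true = e z₂ false →
      γ z₁ (boolSign true * τ z₁ true) ≠ γ z₂ (boolSign false * τ z₂ false) := by
    intro z₁ h₁ z₂ h₂ hee hp
    have key : ∀ z ∈ S, ∀ b, boolSign b * (jacobian (Function.update G r (rolleEvent G q (e z b)))
        (γ z (boolSign b * τ z b))).det ≤ 0 := fun z hz b => by
      have h := hasDerivAt_comp_curve (hκd (e z b)) (hγ z) (boolSign b) (τ z b)
      have hτm : τ z b ∈ Icc 0 (τ z b) := ⟨(hτ z hz b).le, le_rfl⟩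
      rw [hφ _ (hfib z hz _) (hle z hz b _ hτm).1, one_mul] at h
      refine h.nonpos_of_left_min (hτ z hz b) fun u hu => ?_
      rw [he z hz b]
      exact (hle z hz b u hu).2.2
    have k1 := key z₁ h₁ true
    have k2 := key z₂ h₂ false
    rw [← hp, ← hee] at k2
    refine hreg (e z₁ true) _ (hfib z₁ h₁ _) (he z₁ h₁ true) ?_
    simp only [boolSign, if_true, one_mul, Bool.false_eq_true, if_false, neg_mul] at k1 k2 ⊢
    linarith
  let f : (ι → ℝ) × Bool → (Bool ⊕ β) × (ι → ℝ) :=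
    fun x => (e x.1 x.2, γ x.1 (boolSign x.2 * τ x.1 x.2))
  have hinj : Set.InjOn f (S ×ˢ (Finset.univ : Finset Bool) : Finset _) := by
    rintro ⟨z₁, b₁⟩ h₁ ⟨z₂, b₂⟩ h₂ h
    replace h₁ : z₁ ∈ S := by simpa using h₁
    replace h₂ : z₂ ∈ S := by simpa using h₂
    obtain ⟨hee, hp⟩ := Prod.mk.inj h
    simp only at hee hp
    cases b₁ <;> cases b₂
    · rcases le_total (τ z₁ false) (τ z₂ false) with hl | hl
      · rw [hsame z₁ h₁ z₂ h₂ _ hp hl]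
      · rw [hsame z₂ h₂ z₁ h₁ _ hp.symm hl]
    · exact absurd hp.symm (hopp z₂ h₂ z₁ h₁ hee.symm)
    · exact absurd hp (hopp z₁ h₁ z₂ h₂ hee)
    · rcases le_total (τ z₁ true) (τ z₂ true) with hl | hl
      · rw [hsame z₁ h₁ z₂ h₂ _ hp hl]
      · rw [hsame z₂ h₂ z₁ h₁ _ hp.symm hl]
  have hcard : (((S ×ˢ (Finset.univ : Finset Bool)).image f).card : ℝ) = 2 * S.card := by
    rw [Finset.card_image_of_injOn hinj, Finset.card_product]
    simp [mul_comm]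
  rw [← hcard]
  refine card_le_sum_fibers _ B fun e' => hB e' _ fun w hw => ?_
  simp only [Finset.mem_image, Finset.mem_filter, Finset.mem_product, f] at hw
  obtain ⟨⟨e'', w'⟩, ⟨⟨⟨z, b⟩, ⟨hz, -⟩, hzb⟩, rfl⟩, rfl⟩ := hw
  obtain ⟨rfl, rfl⟩ := Prod.mk.inj hzb
  exact ⟨hfib z hz _, he z hz b⟩

lemma jacobian_sub_const (F : ι → (ι → ℝ) → ℝ) (c w : ι → ℝ) :
    jacobian (fun a w => F a w - c a) w = jacobian F w := by
  ext a b
  simp only [jacobian]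
  rw [fderiv_sub_const]

/-- Khovanskii's Rolle theorem: the number of nondegenerate zeros of a system is bounded by the
numbers of nondegenerate zeros of the systems obtained by replacing one equation by the Jacobian
or by one of the functions `q i` describing a compact piece of the curve. -/
theorem two_mul_card_le {F : ι → (ι → ℝ) → ℝ} (hF : ∀ a, ContDiff ℝ (⊤ : ℕ∞) (F a))
    (hq : ∀ i, ContDiff ℝ (⊤ : ℕ∞) (q i))
    (hbdd : ∀ t > 0, ∀ c : ι → ℝ,
      Bornology.IsBounded {w | (∀ a ≠ r, F a w = c a) ∧ ∀ i, t ≤ q i w})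
    (B : Bool ⊕ β → ℝ)
    (hB : ∀ e, ∀ c : ι → ℝ,
      NondegBound (fun a w => Function.update F r (rolleEvent F q e) a w - c a) (B e))
    (S : Finset (ι → ℝ)) (hS : ∀ z ∈ S, IsNondegZero F z) (hSq : ∀ z ∈ S, ∀ i, 0 < q i z) :
    2 * (S.card : ℝ) ≤ ∑ e, B e := by
  classical
  have hJc : Continuous fun w => (jacobian F w).det :=
    continuous_det_jacobian fun a => (hF a).of_le (by simp)
  obtain ⟨δ, hδ, hδ0⟩ : ∃ δ : ℝ, (∀ z ∈ S, δ < |(jacobian F z).det| ∧ ∀ i, δ < q i z) ∧ 0 < δ := by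
    have : ∀ᶠ δ in 𝓝[>] (0 : ℝ), ∀ z ∈ S, δ < |(jacobian F z).det| ∧ ∀ i, δ < q i z := by
      rw [Filter.eventually_all_finset]
      refine fun z hz => Filter.Eventually.and ?_ (Filter.eventually_all.2 fun i => ?_)
      · exact (eventually_lt_nhds (abs_pos.2 (hS z hz).2)).filter_mono nhdsWithin_le_nhds
      · exact (eventually_lt_nhds (hSq z hz i)).filter_mono nhdsWithin_le_nhds
    exact (this.and self_mem_nhdsWithin).exists
  obtain ⟨U, hU, hUd⟩ := S.exists_disjoint_nhds
  have hpert := eventually_exists_perturbed_zero (fun a => (hF a).of_le (by simp)) S hS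
    (fun z => U z ∩ ({w | δ < |(jacobian F w).det|} ∩ {w | ∀ i, δ < q i w})) fun z hz =>
      inter_mem (hU z) (inter_mem
        (hJc.abs.continuousAt.eventually (eventually_gt_nhds (hδ z hz).1))
        (Filter.eventually_all.2 fun i =>
          (hq i).continuous.continuousAt.eventually (eventually_gt_nhds ((hδ z hz).2 i))))
  have hupd : Tendsto (fun c : ι → ℝ => Function.update c r 0) (𝓝 0) (𝓝 0) := by
    have : Continuous fun c : ι → ℝ => Function.update c r 0 := by fun_prop
    simpa using this.tendsto 0
  obtain ⟨ε, hε, hball⟩ := Metric.eventually_nhds_iff_ball.1 (hupd.eventually hpert)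
  have hκd : ∀ e, Differentiable ℝ (rolleEvent F q e) := by
    rintro (b | i)
    · exact ((contDiff_det (contDiff_jacobian_entry hF)).differentiable (by simp)).const_mul _
    · exact (hq i).differentiable (by simp)
  have hae : ∀ᵐ c : ι → ℝ, ∀ e, ∀ w,
      (∀ a, Function.update F r (rolleEvent F q e) a w = c a) →
        (jacobian (Function.update F r (rolleEvent F q e)) w).det ≠ 0 := by
    refine ae_all_iff.2 fun e => ae_forall_det_jacobian_ne_zero fun a => ?_
    rcases eq_or_ne a r with rfl | h
    · simpa using hκd e
    · simpa [Function.update_of_ne h] using (hF a).differentiable (by simp)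
  obtain ⟨c, hcreg, hc, hcr, hcδ⟩ : ∃ c : ι → ℝ, (∀ e, ∀ w,
      (∀ a, Function.update F r (rolleEvent F q e) a w = c a) →
        (jacobian (Function.update F r (rolleEvent F q e)) w).det ≠ 0) ∧
      c ∈ Metric.ball 0 ε ∧ 0 < c r ∧ c r < δ := by
    have hopen : IsOpen (Metric.ball (0 : ι → ℝ) ε ∩ ({c | 0 < c r} ∩ {c | c r < δ})) :=
      Metric.isOpen_ball.inter ((isOpen_lt continuous_const (continuous_apply r)).inter
        (isOpen_lt (continuous_apply r) continuous_const))
    have hpos : 0 < min ε δ / 2 := by positivity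
    obtain ⟨c, hc, hreg⟩ := (Measure.dense_of_ae hae).inter_open_nonempty _ hopen
      ⟨Pi.single r (min ε δ / 2), by
        rw [mem_ball_zero_iff, Pi.norm_single, Real.norm_of_nonneg hpos.le]
        linarith [min_le_left ε δ], by simpa using hpos, by
        have := min_le_right ε δ
        simp only [mem_ofPred_eq, Pi.single_eq_same]
        linarith⟩
    exact ⟨c, hreg, hc.1, hc.2.1, hc.2.2⟩
  choose! z' hz'U hz' using hball c hc
  set c' := Function.update c r 0
  set G : ι → (ι → ℝ) → ℝ := fun a w => F a w - c' a with hGdef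
  have hJG : ∀ w, jacobian G w = jacobian F w := jacobian_sub_const F c'
  have hev : rolleEvent G q = rolleEvent F q := by
    funext e; rcases e with b | i <;> simp [rolleEvent, hJG]
  have hfib : ∀ w, (∀ a ≠ r, G a w = 0) ↔ ∀ a ≠ r, F a w = c a := fun w =>
    forall₂_congr fun a ha => by simp [G, c', Function.update_of_ne ha, sub_eq_zero]
  have hjac : ∀ κ w, jacobian (Function.update G r κ) w = jacobian (Function.update F r κ) w :=
    fun κ w => by rw [jacobian_update, jacobian_update, hJG]
  have hfull : ∀ w κ, (∀ a ≠ r, G a w = 0) → κ w = c r → ∀ a, Function.update F r κ a w = c a := by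
    intro w κ h1 h2 a
    rcases eq_or_ne a r with rfl | h
    · simpa using h2
    · simpa [Function.update_of_ne h] using (hfib w).1 h1 a h
  have hinj : Set.InjOn z' (S : Set (ι → ℝ)) := fun x hx y hy h => by
    by_contra hne
    exact Set.disjoint_left.1 (hUd x hx y hy hne) (hz'U x hx).1 (h ▸ (hz'U y hy).1)
  rw [← Finset.card_image_of_injOn hinj]
  have hmem : ∀ {p : (ι → ℝ) → Prop}, (∀ z ∈ S, p (z' z)) → ∀ w ∈ S.image z', p w :=
    fun h w hw => by
    obtain ⟨z, hz, rfl⟩ := Finset.mem_image.1 hw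
    exact h z hz
  refine two_mul_card_le_of_regular (G := G) (q := q) (r := r) (t := c r)
    (fun a => (hF a).sub contDiff_const) hq hcr ?_ ?_ _
    (hmem fun z hz a => ?_) (hmem fun z hz => ?_)
    (hmem fun z hz i => ?_) B fun e T hT => ?_
  · simp only [hfib]
    exact hbdd _ hcr c
  · intro e w h1 h2
    rw [hjac, hev]
    exact hcreg e w (hfull w _ h1 (by rwa [← hev]))
  · simp only [G]
    rw [hz' z hz a, sub_self]
  · rw [hJG]
    exact hcδ.trans (hz'U z hz).2.1
  · exact hcδ.trans ((hz'U z hz).2.2 i)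
  · refine hB e c T fun w hw => ?_
    have := hfull w (rolleEvent F q e) (hT w hw).1 (by rw [← hev]; exact (hT w hw).2)
    refine ⟨fun a => sub_eq_zero.2 (this a), ?_⟩
    rw [jacobian_sub_const]
    exact hcreg e w this

end Rolle

section ExpRow

open MvPolynomial

variable {ι : Type*} [Fintype ι] [DecidableEq ι]

/-- A function that is a polynomial in the `exp (w b)` plus a linear form in `w`. -/
noncomputable def expRow (P : MvPolynomial ι ℝ) (β : ι → ℝ) (w : ι → ℝ) : ℝ :=
  eval (fun b => Real.exp (w b)) P + ∑ b, β b * w b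

lemma contDiff_expRow (P : MvPolynomial ι ℝ) (β : ι → ℝ) {m : WithTop ℕ∞} :
    ContDiff ℝ m (expRow P β) := by
  refine ((P.contDiff_eval).comp (contDiff_pi.2 fun b => (contDiff_apply ℝ ℝ b).exp)).add ?_
  exact ContDiff.sum fun b _ => contDiff_const.mul (contDiff_apply ℝ ℝ b)

lemma fderiv_expRow_single (P : MvPolynomial ι ℝ) (β w : ι → ℝ) (b : ι) :
    fderiv ℝ (expRow P β) w (Pi.single b 1) =
      eval (fun b => Real.exp (w b)) (X b * pderiv b P + C (β b)) := by
  have h1 : HasFDerivAt (fun w : ι → ℝ => fun b => Real.exp (w b))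
      (ContinuousLinearMap.pi fun b => Real.exp (w b) •
        ContinuousLinearMap.proj (R := ℝ) (φ := fun _ : ι => ℝ) b) w :=
    hasFDerivAt_pi.2 fun b => (hasFDerivAt_apply (𝕜 := ℝ) b w).exp
  have h2 := (P.hasFDerivAt_eval _).comp w h1
  have h3 : HasFDerivAt (fun w : ι → ℝ => ∑ b, β b * w b)
      (∑ b, β b • ContinuousLinearMap.proj (R := ℝ) (φ := fun _ : ι => ℝ) b) w :=
    HasFDerivAt.fun_sum fun b _ => (hasFDerivAt_apply (𝕜 := ℝ) b w).const_mul (β b)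
  have h4 := (h2.add h3).fderiv
  change fderiv ℝ (expRow P β) w = _ at h4
  rw [h4]
  simp [Pi.single_apply, mul_comm]

lemma totalDegree_X_mul_pderiv_le (P : MvPolynomial ι ℝ) (b : ι) :
    (X b * pderiv b P).totalDegree ≤ P.totalDegree := by
  conv_lhs => rw [P.as_sum, map_sum, Finset.mul_sum]
  refine totalDegree_finsetSum_le fun m hm => ?_
  rw [pderiv_monomial]
  by_cases hb : m b = 0
  · simp [hb]
  · have : X b * monomial (m - Finsupp.single b 1) (coeff m P * (m b : ℝ))
        = monomial m (coeff m P * (m b : ℝ)) := by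
      rw [X, monomial_mul, one_mul, add_tsub_cancel_of_le]
      rw [Finsupp.single_le_iff]; omega
    rw [this]
    exact (totalDegree_monomial_le _ _).trans (le_totalDegree hm)

lemma totalDegree_det_le (A : Matrix ι ι (MvPolynomial ι ℝ)) (d : ι → ℕ)
    (hA : ∀ a b, (A a b).totalDegree ≤ d a) : A.det.totalDegree ≤ ∑ a, d a := by
  rw [Matrix.det_apply]
  refine totalDegree_finsetSum_le fun σ _ => (totalDegree_smul_le _ _).trans ?_
  refine (totalDegree_finsetProd _ _).trans ?_
  rw [← Equiv.sum_comp σ d]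
  exact Finset.sum_le_sum fun i _ => hA _ _

/-- The Jacobian of a system of functions of type `expRow`, as a polynomial. -/
noncomputable def jacobianPoly (P : ι → MvPolynomial ι ℝ) (β : ι → ι → ℝ) : MvPolynomial ι ℝ :=
  Matrix.det (Matrix.of fun a b => X b * pderiv b (P a) + C (β a b))

lemma totalDegree_jacobianPoly_le {P : ι → MvPolynomial ι ℝ} (β : ι → ι → ℝ) {d : ι → ℕ}
    (hP : ∀ a, (P a).totalDegree ≤ d a) : (jacobianPoly P β).totalDegree ≤ ∑ a, d a := by
  refine totalDegree_det_le _ _ fun a b => (totalDegree_add _ _).trans (max_le ?_ ?_)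
  · exact (totalDegree_X_mul_pderiv_le _ _).trans (hP a)
  · simp

lemma eval_jacobianPoly (P : ι → MvPolynomial ι ℝ) (β : ι → ι → ℝ) (w : ι → ℝ) :
    eval (fun b => Real.exp (w b)) (jacobianPoly P β) =
      (jacobian (fun a => expRow (P a) (β a)) w).det := by
  rw [jacobianPoly, RingHom.map_det]
  congr 1
  ext a b
  rw [jacobian, fderiv_expRow_single]
  rfl

/-- Bézout's bound in exponential coordinates. -/
lemma nondegBound_expRow_zero (P : ι → MvPolynomial ι ℝ) (d : ι → ℕ)
    (hP : ∀ a, (P a).totalDegree ≤ d a) :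
    NondegBound (fun a => expRow (P a) 0) (∏ a, d a : ℕ) := by
  intro S hS
  have hinj : Function.Injective fun (w : ι → ℝ) b => Real.exp (w b) := fun x y h =>
    funext fun b => Real.exp_injective (congrFun h b)
  rw [← Finset.card_image_of_injective S hinj]
  refine nondegBound_eval P d hP _ fun z hz => ?_
  obtain ⟨w, hw, rfl⟩ := Finset.mem_image.1 hz
  refine ⟨fun a => by simpa [expRow] using (hS w hw).1 a, fun h => (hS w hw).2 ?_⟩
  have : jacobian (fun a => expRow (P a) 0) w =
      jacobian (fun a w => eval w (P a)) (fun b => Real.exp (w b)) *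
        Matrix.diagonal fun b => Real.exp (w b) := by
    ext a b
    rw [Matrix.mul_diagonal, jacobian, fderiv_expRow_single, jacobian, fderiv_eval_single]
    simp [mul_comm]
  rw [this, Matrix.det_mul, h, zero_mul]

end ExpRow

section Induction

open MvPolynomial

variable {n k : ℕ}

/-- Whether a row of the system is still linear in the logarithmic coordinates. -/
def isLinRow (j : ℕ) : Fin n ⊕ Fin k → Prop := Sum.elim (fun _ => False) fun l => (l : ℕ) < j

instance (j : ℕ) : DecidablePred (isLinRow (n := n) (k := k) j) := fun a =>
  match a with
  | Sum.inl _ => inferInstanceAs (Decidable False)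
  | Sum.inr l => inferInstanceAs (Decidable ((l : ℕ) < j))

/-- The coefficients of the linear form `w (inr l) - ∑ i, b l i * w (inl i)` -/
def linForm (b : Fin k → Fin n → ℝ) (l : Fin k) : Fin n ⊕ Fin k → ℝ :=
  Sum.elim (fun i => -b l i) (Pi.single l 1)

/-- The coefficients of the linear parts when the first `j` extra rows are linear. -/
def linPart (b : Fin k → Fin n → ℝ) (j : ℕ) : Fin n ⊕ Fin k → Fin n ⊕ Fin k → ℝ :=
  Sum.elim 0 fun l => if (l : ℕ) < j then linForm b l else 0

/-- The bound of the Rolle–Khovanskii recursion. -/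
noncomputable def rolleBound : ℕ → ℕ → ℕ → ℝ
  | 0, _, _ => 1
  | j + 1, m, D => D * rolleBound j (m + 1) (2 * D) + (m + 2) / 2 * rolleBound j (m + 1) (D + 1)

lemma isLinRow_succ_iff {j : ℕ} (hj : j < k) (a : Fin n ⊕ Fin k) :
    isLinRow (j + 1) a ↔ isLinRow j a ∨ a = Sum.inr ⟨j, hj⟩ := by
  rcases a with i | l
  · simp [isLinRow]
  · simp only [isLinRow, Sum.elim_inr, Sum.inr.injEq, Fin.ext_iff]
    omega

lemma linPart_update {b : Fin k → Fin n → ℝ} {j : ℕ} (hj : j < k) :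
    Function.update (linPart b (j + 1)) (Sum.inr ⟨j, hj⟩) 0 = linPart b j := by
  funext a
  rcases a with i | l
  · simp [linPart]
  · rcases eq_or_ne l ⟨j, hj⟩ with rfl | h
    · simp [linPart]
    · have h' : (l : ℕ) ≠ j := fun h' => h (Fin.ext h')
      have : ((l : ℕ) ≤ j) ↔ ((l : ℕ) < j) := by omega
      simp [linPart, Function.update_of_ne, h, this]

lemma card_not_isLinRow {j : ℕ} (hj : j ≤ k) :
    Fintype.card {a : Fin n ⊕ Fin k // ¬ isLinRow j a} + j = n + k := by
  rw [Fintype.card_subtype_compl]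
  have : Fintype.card {a : Fin n ⊕ Fin k // isLinRow j a} = j := by
    rw [Fintype.card_subtype]
    refine Eq.trans ?_ (Finset.card_fin j)
    refine (Finset.card_bij (fun (l : Fin j) _ => Sum.inr (Fin.castLE hj l)) (fun l _ => ?_)
      (fun l _ l' _ h => ?_) fun a ha => ?_).symm
    · exact Finset.mem_filter.2 ⟨Finset.mem_univ _, l.2⟩
    · simpa using h
    · rcases a with i | l
      · exact absurd (Finset.mem_filter.1 ha).2 id
      · exact ⟨⟨l, (Finset.mem_filter.1 ha).2⟩, Finset.mem_univ _, rfl⟩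
  have h2 : Fintype.card {a : Fin n ⊕ Fin k // isLinRow j a} ≤ n + k := by omega
  simp only [Fintype.card_sum, Fintype.card_fin]
  omega

lemma isBounded_rolle {b : Fin k → Fin n → ℝ} {j : ℕ} (hj : j < k)
    {P : Fin n ⊕ Fin k → MvPolynomial (Fin n ⊕ Fin k) ℝ}
    (hP : ∀ a, isLinRow (j + 1) a → (P a).totalDegree ≤ 0) {t : ℝ} (ht : 0 < t) (R : ℝ)
    (c : Fin n ⊕ Fin k → ℝ) :
    Bornology.IsBounded {w : Fin n ⊕ Fin k → ℝ |
      (∀ a ≠ Sum.inr ⟨j, hj⟩, expRow (P a) (linPart b (j + 1) a) w = c a) ∧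
      (∀ a, ¬ isLinRow j a → t ≤ Real.exp (w a)) ∧ ∀ a, ¬ isLinRow j a → Real.exp (w a) ≤ R} := by
  set M := |Real.log t| + |Real.log R|
  have hM0 : 0 ≤ M := by positivity
  have hfree : ∀ w : Fin n ⊕ Fin k → ℝ, ∀ a, t ≤ Real.exp (w a) →
      Real.exp (w a) ≤ R → |w a| ≤ M := by
    intro w a h1 h2
    have h3 := (Real.log_le_iff_le_exp ht).2 h1
    have h4 := (Real.le_log_iff_exp_le ((Real.exp_pos _).trans_le h2)).2 h2
    rw [abs_le]
    constructor
    · linarith [neg_abs_le (Real.log t), abs_nonneg (Real.log R)]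
    · linarith [le_abs_self (Real.log R), abs_nonneg (Real.log t)]
  suffices ∀ a, ∃ C, ∀ w : Fin n ⊕ Fin k → ℝ,
      (∀ a ≠ Sum.inr ⟨j, hj⟩, expRow (P a) (linPart b (j + 1) a) w = c a) →
      (∀ a, ¬ isLinRow j a → t ≤ Real.exp (w a)) → (∀ a, ¬ isLinRow j a → Real.exp (w a) ≤ R) →
      |w a| ≤ C by
    choose C hC using this
    refine (isCompact_Icc (a := -C) (b := C)).isBounded.subset fun w hw => ?_
    exact ⟨fun a => (abs_le.1 (hC a w hw.1 hw.2.1 hw.2.2)).1,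
      fun a => (abs_le.1 (hC a w hw.1 hw.2.1 hw.2.2)).2⟩
  intro a
  by_cases ha : isLinRow j a
  swap
  · exact ⟨M, fun w _ h1 h2 => hfree w a (h1 a ha) (h2 a ha)⟩
  rcases a with i | l
  · exact absurd ha (by simp [isLinRow])
  have hl : (l : ℕ) < j := ha
  have hl1 : isLinRow (n := n) (k := k) (j + 1) (Sum.inr l) := by
    simp only [isLinRow, Sum.elim_inr]; omega
  have hC := totalDegree_eq_zero_iff_eq_C.1 (Nat.le_zero.1 (hP _ hl1))
  refine ⟨|c (Sum.inr l)| + |(P (Sum.inr l)).coeff 0| + ∑ i, |b l i| * M, fun w h0 h1 h2 => ?_⟩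
  have h := h0 (Sum.inr l) (fun h => by simp only [Sum.inr.injEq, Fin.ext_iff] at h; omega)
  rw [expRow, hC, eval_C] at h
  simp only [linPart, Sum.elim_inr, show (l : ℕ) < j + 1 by omega, if_true, linForm,
    Fintype.sum_sum_type, Sum.elim_inl, neg_mul, Finset.sum_neg_distrib, Pi.single_apply, ite_mul,
    one_mul, zero_mul, Finset.sum_ite_eq', Finset.mem_univ] at h
  have hw : w (Sum.inr l) =
      c (Sum.inr l) - (P (Sum.inr l)).coeff 0 + ∑ i, b l i * w (Sum.inl i) := by
    linarith
  rw [hw]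
  refine (abs_add_le _ _).trans (add_le_add (abs_sub _ _) ?_)
  refine (Finset.abs_sum_le_sum_abs _ _).trans (Finset.sum_le_sum fun i _ => ?_)
  rw [abs_mul]
  exact mul_le_mul_of_nonneg_left
    (hfree w _ (h1 _ (by simp [isLinRow])) (h2 _ (by simp [isLinRow])))
    (abs_nonneg _)

lemma update_expRow_sub {b : Fin k → Fin n → ℝ} {j : ℕ} (hj : j < k)
    (P : Fin n ⊕ Fin k → MvPolynomial (Fin n ⊕ Fin k) ℝ) (Q : MvPolynomial (Fin n ⊕ Fin k) ℝ)
    (c : Fin n ⊕ Fin k → ℝ) :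
    (fun a w => Function.update (fun a => expRow (P a) (linPart b (j + 1) a)) (Sum.inr ⟨j, hj⟩)
      (expRow Q 0) a w - c a) =
    fun a => expRow (Function.update P (Sum.inr ⟨j, hj⟩) Q a - C (c a)) (linPart b j a) := by
  funext a w
  rw [← linPart_update hj]
  rcases eq_or_ne a (Sum.inr ⟨j, hj⟩) with rfl | h
  · simp [expRow]
  · simp only [Function.update_of_ne h, expRow, map_sub, eval_C]
    ring

/-- The bound on the number of nondegenerate zeros of a partially linear exponential system. -/
theorem nondegBound_expRow_linPart (b : Fin k → Fin n → ℝ) (j m : ℕ) (hj : j ≤ k)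
    (hm : m + j = n + k) (P : Fin n ⊕ Fin k → MvPolynomial (Fin n ⊕ Fin k) ℝ)
    (d : Fin n ⊕ Fin k → ℕ) (hP : ∀ a, (P a).totalDegree ≤ d a)
    (hd : ∀ a, isLinRow j a → d a = 0) :
    NondegBound (fun a => expRow (P a) (linPart b j a))
      ((∏ a, if isLinRow j a then 1 else (d a : ℝ)) * rolleBound j m (∑ a, d a)) := by
  induction j generalizing m P d with
  | zero =>
    have h0 : (fun a => expRow (P a) (linPart b 0 a)) = fun a => expRow (P a) 0 := by
      funext a
      rcases a with i | l <;> simp [linPart]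
    have h1 : ∀ a : Fin n ⊕ Fin k, ¬ isLinRow 0 a := by
      rintro (i | l) <;> simp [isLinRow]
    rw [h0]
    simpa [rolleBound, h1] using nondegBound_expRow_zero P d hP
  | succ j ih =>
    have hjk : j < k := hj
    set r : Fin n ⊕ Fin k := Sum.inr ⟨j, hjk⟩ with hr
    have hrl : isLinRow (j + 1) r := (isLinRow_succ_iff hjk r).2 (Or.inr rfl)
    have hrn : ¬ isLinRow j r := lt_irrefl j
    have hdr : d r = 0 := hd r hrl
    have key : ∀ (Q : MvPolynomial (Fin n ⊕ Fin k) ℝ) (e : ℕ) (c : Fin n ⊕ Fin k → ℝ),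
        Q.totalDegree ≤ e →
        NondegBound (fun a w => Function.update (fun a => expRow (P a) (linPart b (j + 1) a)) r
          (expRow Q 0) a w - c a)
          (((∏ a, if isLinRow (j + 1) a then 1 else (d a : ℝ)) * e) *
            rolleBound j (m + 1) (∑ a, d a + e)) := by
      intro Q e c hQ
      rw [update_expRow_sub hjk]
      have := ih (m + 1) hjk.le (by omega)
        (fun a => Function.update P r Q a - C (c a)) (Function.update d r e) (fun a => ?_)
        (fun a ha => ?_)
      · convert this using 2
        · rw [← Finset.mul_prod_erase _ _ (Finset.mem_univ r),
            ← Finset.mul_prod_erase _ _ (Finset.mem_univ r), if_pos hrl, if_neg hrn, one_mul,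
            Function.update_self, mul_comm]
          congr 1
          refine Finset.prod_congr rfl fun a ha => ?_
          have ha' := Finset.ne_of_mem_erase ha
          simp [isLinRow_succ_iff hjk, ← hr, ha']
        · congr 1
          rw [← Finset.add_sum_erase _ _ (Finset.mem_univ r),
            ← Finset.add_sum_erase _ _ (Finset.mem_univ r), Function.update_self, hdr, zero_add,
            add_comm]
          exact congrArg (e + ·) (Finset.sum_congr rfl fun a ha =>
            (Function.update_of_ne (Finset.ne_of_mem_erase ha) _ _).symm)
      · refine (totalDegree_sub _ _).trans (max_le ?_ (by simp))
        rcases eq_or_ne a r with rfl | h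
        · simpa using hQ
        · simpa [Function.update_of_ne h] using hP a
      · have hne : a ≠ r := fun h => hrn (h ▸ ha)
        rw [Function.update_of_ne hne]
        exact hd a ((isLinRow_succ_iff hjk a).2 (Or.inl ha))
    intro S hS
    obtain ⟨R, hR⟩ := Finset.exists_le
      (S.image fun w => ∑ a : {a : Fin n ⊕ Fin k // ¬ isLinRow j a}, Real.exp (w a.1) + 1)
    let Q : Option {a : Fin n ⊕ Fin k // ¬ isLinRow j a} → MvPolynomial (Fin n ⊕ Fin k) ℝ
      | none => C R - ∑ a : {a : Fin n ⊕ Fin k // ¬ isLinRow j a}, X a.1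
      | some a => X a.1
    have hQd : ∀ i, (Q i).totalDegree ≤ 1 := by
      rintro (_ | a)
      · refine (totalDegree_sub _ _).trans (max_le (by simp) ?_)
        exact totalDegree_finsetSum_le fun a _ => by simp
      · simp [Q]
    have hQnone : ∀ w, expRow (Q none) 0 w =
        R - ∑ a : {a : Fin n ⊕ Fin k // ¬ isLinRow j a}, Real.exp (w a) := by
      intro w; simp [expRow, Q]
    have hQsome : ∀ a w, expRow (Q (some a)) 0 w = Real.exp (w a) := by
      intro a w; simp [expRow, Q]
    clear_value Q
    set Λ : ℝ := ∏ a, if isLinRow (j + 1) a then 1 else (d a : ℝ)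
    set D : ℕ := ∑ a, d a
    have hmain := two_mul_card_le (r := r) (F := fun a => expRow (P a) (linPart b (j + 1) a))
      (q := fun i => expRow (Q i) 0) (fun a => contDiff_expRow _ _) (fun i => contDiff_expRow _ _)
      (fun t ht c =>
        (isBounded_rolle (b := b) hjk (fun a ha => (hP a).trans (hd a ha).le) ht R c).subset ?_)
      (Sum.elim (fun _ => Λ * D * rolleBound j (m + 1) (D + D))
        fun _ => Λ * (1 : ℕ) * rolleBound j (m + 1) (D + 1)) ?_ S hS ?_
    · have hcard := card_not_isLinRow (n := n) hjk.le
      have hcard' : Fintype.card {a : Fin n ⊕ Fin k // ¬ isLinRow j a} = m + 1 := by omega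
      simp only [Fintype.sum_sum_type, Sum.elim_inl, Sum.elim_inr, Finset.sum_const,
        Finset.card_univ, Fintype.card_bool, Fintype.card_option, hcard', nsmul_eq_mul,
        Nat.cast_one, mul_one, Nat.cast_add, Nat.cast_ofNat] at hmain
      rw [rolleBound, two_mul D]
      linarith
    · rintro w ⟨h1, h2⟩
      refine ⟨h1, fun a ha => ?_, fun a ha => ?_⟩
      · exact (h2 (some ⟨a, ha⟩)).trans (hQsome ⟨a, ha⟩ w).le
      · have h3 := h2 none
        simp only [hQnone] at h3
        have := Finset.single_le_sum (f := fun a : {a : Fin n ⊕ Fin k // ¬ isLinRow j a} =>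
          Real.exp (w a)) (fun a _ => (Real.exp_pos _).le) (Finset.mem_univ ⟨a, ha⟩)
        linarith
    · rintro (s | i) c
      · have : rolleEvent (fun a => expRow (P a) (linPart b (j + 1) a)) (fun i => expRow (Q i) 0)
            (Sum.inl s) = expRow (C (boolSign s) * jacobianPoly P (linPart b (j + 1))) 0 := by
          funext w
          simp only [rolleEvent, Sum.elim_inl]
          rw [← eval_jacobianPoly]
          simp [expRow]
        rw [this]
        refine key _ D c ((totalDegree_mul _ _).trans ?_)
        rw [totalDegree_C, zero_add]
        exact totalDegree_jacobianPoly_le _ hP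
      · exact key _ 1 c (hQd i)
    · rintro z hz (_ | a)
      · have := hR _ (Finset.mem_image_of_mem _ hz)
        rw [hQnone]; linarith
      · rw [hQsome]; exact Real.exp_pos _

end Induction

section ExpSumLine

lemma card_le_of_rolle {f g : ℝ → ℝ}
    (hfg : ∀ x y, x < y → f x = 0 → f y = 0 → ∃ z ∈ Ioo x y, g z = 0) {N : ℕ}
    (hg : ∀ T : Finset ℝ, (∀ x ∈ T, g x = 0) → T.card ≤ N) (S : Finset ℝ)
    (hS : ∀ x ∈ S, f x = 0) : S.card ≤ N + 1 := by
  classical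
  have : ∀ p : ℝ × ℝ, ∃ z, p.1 < p.2 → f p.1 = 0 → f p.2 = 0 → z ∈ Ioo p.1 p.2 ∧ g z = 0 := by
    intro p
    by_cases h : p.1 < p.2 ∧ f p.1 = 0 ∧ f p.2 = 0
    · obtain ⟨z, hz⟩ := hfg _ _ h.1 h.2.1 h.2.2
      exact ⟨z, fun _ _ _ => hz⟩
    · exact ⟨0, fun h1 h2 h3 => absurd ⟨h1, h2, h3⟩ h⟩
  choose z hz using this
  let T := ((S ×ˢ S).filter fun p => p.1 < p.2).image z
  refine (Finset.card_le_of_interleaved (t := T) fun x hx y hy hxy _ => ?_).trans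
    (Nat.add_le_add_right (hg T fun w hw => ?_) 1)
  · exact ⟨z (x, y), Finset.mem_image_of_mem _ (by simp [hx, hy, hxy]),
      (hz (x, y) hxy (hS x hx) (hS y hy)).1⟩
  · obtain ⟨p, hp, rfl⟩ := Finset.mem_image.1 hw
    simp only [Finset.mem_filter, Finset.mem_product] at hp
    exact (hz p hp.2 (hS _ hp.1.1) (hS _ hp.1.2)).2

/-- A nonzero real exponential sum with `N` terms has fewer than `N` real zeros. -/
lemma card_zeros_expSum_lt {ι : Type*} (s : Finset ι) (γ β : ι → ℝ) (t₀ : ℝ)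
    (h₀ : ∑ l ∈ s, γ l * Real.exp (β l * t₀) ≠ 0) (S : Finset ℝ)
    (hS : ∀ t ∈ S, ∑ l ∈ s, γ l * Real.exp (β l * t) = 0) : S.card < s.card := by
  classical
  induction s using Finset.induction_on generalizing γ β t₀ S with
  | empty => simp at h₀
  | insert a s ha ih =>
    rw [Finset.card_insert_of_notMem ha, Nat.lt_succ_iff]
    let f : ℝ → ℝ := fun t => γ a + ∑ l ∈ s, γ l * Real.exp ((β l - β a) * t)
    let g : ℝ → ℝ := fun t => ∑ l ∈ s, γ l * (β l - β a) * Real.exp ((β l - β a) * t)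
    have hf : ∀ t, f t = Real.exp (-(β a * t)) * ∑ l ∈ insert a s, γ l * Real.exp (β l * t) := by
      intro t
      rw [Finset.sum_insert ha, mul_add, Finset.mul_sum]
      refine congrArg₂ (· + ·) ?_ ?_
      · rw [mul_left_comm, ← Real.exp_add]; simp
      · refine Finset.sum_congr rfl fun l _ => ?_
        rw [mul_left_comm, ← Real.exp_add]; ring_nf
    have hfg : ∀ t, HasDerivAt f (g t) t := by
      intro t
      refine (HasDerivAt.fun_sum fun l _ => ?_).const_add _
      have := (((hasDerivAt_id t).const_mul (β l - β a)).exp).const_mul (γ l)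
      exact this.congr_deriv (by simp only [id]; ring)
    have hf0 : ∀ t ∈ S, f t = 0 := fun t ht => by rw [hf, hS t ht, mul_zero]
    have hft₀ : f t₀ ≠ 0 := by
      rw [hf]; exact mul_ne_zero (Real.exp_pos _).ne' h₀
    by_cases hg : ∀ t, g t = 0
    · have hconst : ∀ t, f t = f t₀ := fun t =>
        is_const_of_deriv_eq_zero (fun t => (hfg t).differentiableAt)
          (fun t => by rw [(hfg t).deriv, hg]) _ _
      have : S = ∅ := Finset.eq_empty_of_forall_notMem fun t ht =>
        hft₀ (by rw [← hconst t, hf0 t ht])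
      simp [this]
    · push Not at hg
      obtain ⟨t₁, ht₁⟩ := hg
      have hlt := fun T hT => ih (fun l => γ l * (β l - β a)) (fun l => β l - β a) t₁ ht₁ T hT
      have hpos : 0 < s.card := (Nat.zero_le _).trans_lt (hlt ∅ (by simp))
      have := card_le_of_rolle (f := f) (g := g) (N := s.card - 1)
        (fun x y hxy hx hy => exists_hasDerivAt_eq_zero hxy
          (fun t _ => (hfg t).continuousAt.continuousWithinAt) (hx.trans hy.symm) fun t _ => hfg t)
        (fun T hT => Nat.le_sub_one_of_lt (hlt T hT)) S hf0
      omega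

end ExpSumLine

section Topology

variable {E : Type*} [MetricSpace E]

lemma exists_clopen_of_connectedComponentIn_ne {Y K : Set E} (hK : IsCompact K) (hKY : K ⊆ Y)
    {x y : E} (hx : x ∈ K) (hy : y ∈ K)
    (hne : connectedComponentIn Y x ≠ connectedComponentIn Y y) :
    ∃ A ⊆ K, IsCompact A ∧ IsCompact (K \ A) ∧ x ∈ A ∧ y ∉ A := by
  have : CompactSpace K := isCompact_iff_compactSpace.1 hK
  have h : (⟨y, hy⟩ : K) ∉ connectedComponent (⟨x, hx⟩ : K) := by
    intro h
    refine hne (connectedComponentIn_eq ?_)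
    refine connectedComponentIn_mono x hKY ?_
    rw [connectedComponentIn_eq_image hx]
    exact ⟨_, h, rfl⟩
  rw [connectedComponent_eq_iInter_isClopen] at h
  simp only [mem_iInter, not_forall] at h
  obtain ⟨⟨A, hA, hxA⟩, hyA⟩ := h
  refine ⟨Subtype.val '' A, Subtype.coe_image_subset K A, ?_, ?_, ⟨_, hxA, rfl⟩, ?_⟩
  · exact hA.1.isCompact.image continuous_subtype_val
  · have : K \ Subtype.val '' A = Subtype.val '' Aᶜ := by
      ext z
      simp only [Set.mem_sdiff, mem_image, Subtype.exists, mem_compl_iff]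
      grind
    rw [this]
    exact hA.2.isClosed_compl.isCompact.image continuous_subtype_val
  · rintro ⟨z, hz, rfl⟩
    exact hyA hz

/-- Points of a compact set lying in distinct components of a larger set have disjoint open
neighbourhoods whose frontiers miss the compact set. -/
lemma exists_open_separation {Y K : Set E} (hK : IsCompact K) (hKY : K ⊆ Y) (S : Finset E)
    (hS : ∀ x ∈ S, x ∈ K) (hne : ∀ x ∈ S, ∀ y ∈ S, x ≠ y →
      connectedComponentIn Y x ≠ connectedComponentIn Y y) :
    ∃ W : E → Set E, (∀ x ∈ S, IsOpen (W x) ∧ x ∈ W x ∧ Disjoint (frontier (W x)) K) ∧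
      ∀ x ∈ S, ∀ y ∈ S, x ≠ y → Disjoint (W x) (W y) := by
  classical
  have h1 : ∀ x y, ∃ A, x ∈ S → y ∈ S → x ≠ y →
      A ⊆ K ∧ IsCompact A ∧ IsCompact (K \ A) ∧ x ∈ A ∧ y ∉ A := by
    intro x y
    by_cases h : x ∈ S ∧ y ∈ S ∧ x ≠ y
    · obtain ⟨A, hA⟩ := exists_clopen_of_connectedComponentIn_ne hK hKY (hS x h.1) (hS y h.2.1)
        (hne x h.1 y h.2.1 h.2.2)
      exact ⟨A, fun _ _ _ => hA⟩
    · exact ⟨∅, fun a b c => absurd ⟨a, b, c⟩ h⟩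
  choose A hA using h1
  let B : E → Set E := fun x => K ∩ ⋂ y ∈ S.erase x, A x y \ A y x
  have hBmem : ∀ x ∈ S, x ∈ B x := fun x hx => by
    refine ⟨hS x hx, mem_iInter₂.2 fun y hy => ?_⟩
    obtain ⟨hyx, hy⟩ := Finset.mem_erase.1 hy
    exact ⟨(hA x y hx hy hyx.symm).2.2.2.1, (hA y x hy hx hyx).2.2.2.2⟩
  have hAK : ∀ x ∈ S, ∀ y ∈ S.erase x, ∀ z ∈ K, z ∉ A x y \ A y x → z ∈ K \ A x y ∪ A y x := by
    intro x hx y hy z hz h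
    by_cases h' : z ∈ A y x
    · exact Or.inr h'
    · exact Or.inl ⟨hz, fun h'' => h ⟨h'', h'⟩⟩
  have hBc : ∀ x ∈ S, IsCompact (B x) := fun x hx => by
    refine hK.inter_right (isClosed_biInter fun y hy => ?_)
    obtain ⟨hyx, hy⟩ := Finset.mem_erase.1 hy
    have : A x y \ A y x = A x y ∩ (K \ A y x) := by
      ext z
      exact ⟨fun h => ⟨h.1, (hA x y hx hy hyx.symm).1 h.1, h.2⟩, fun h => ⟨h.1, h.2.2⟩⟩
    rw [this]
    exact ((hA x y hx hy hyx.symm).2.1.inter (hA y x hy hx hyx).2.2.1).isClosed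
  have hBc' : ∀ x ∈ S, IsCompact (K \ B x) := fun x hx => by
    have : K \ B x = ⋃ y ∈ S.erase x, K \ A x y ∪ A y x := by
      ext z
      constructor
      · rintro ⟨hz, h⟩
        by_contra h'
        refine h ⟨hz, mem_iInter₂.2 fun y hy => ?_⟩
        by_contra h''
        exact h' (mem_iUnion₂.2 ⟨y, hy, hAK x hx y hy z hz h''⟩)
      · intro h
        obtain ⟨y, hy, h⟩ := mem_iUnion₂.1 h
        obtain ⟨hyx, hy'⟩ := Finset.mem_erase.1 hy
        rcases h with h | h
        · exact ⟨h.1, fun hB => h.2 (mem_iInter₂.1 hB.2 y hy).1⟩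
        · exact ⟨(hA y x hy' hx hyx).1 h, fun hB => (mem_iInter₂.1 hB.2 y hy).2 h⟩
    rw [this]
    refine Finset.isCompact_biUnion _ fun y hy => ?_
    obtain ⟨hyx, hy⟩ := Finset.mem_erase.1 hy
    exact (hA x y hx hy hyx.symm).2.2.1.union (hA y x hy hx hyx).2.1
  have hev : ∀ s t : Set E, IsCompact s → IsCompact t → Disjoint s t →
      ∀ᶠ δ in 𝓝[>] (0 : ℝ), Disjoint (Metric.cthickening δ s) (Metric.cthickening δ t) := by
    intro s t hs ht hst
    obtain ⟨δ, hδ, h⟩ := hst.exists_cthickenings hs ht.isClosed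
    filter_upwards [Ioc_mem_nhdsGT hδ] with δ' hδ'
    exact h.mono (Metric.cthickening_mono hδ'.2 _) (Metric.cthickening_mono hδ'.2 _)
  have hdisj : ∀ x ∈ S, ∀ y ∈ S, x ≠ y → Disjoint (B x) (B y) := fun x hx y hy hxy => by
    refine disjoint_left.2 fun z h1 h2 => ?_
    have h3 := mem_iInter₂.1 h1.2 y (Finset.mem_erase.2 ⟨hxy.symm, hy⟩)
    have h4 := mem_iInter₂.1 h2.2 x (Finset.mem_erase.2 ⟨hxy, hx⟩)
    exact h3.2 h4.1
  have hδ : ∀ᶠ δ in 𝓝[>] (0 : ℝ), 0 < δ ∧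
      (∀ x ∈ S, Disjoint (Metric.cthickening δ (B x)) (Metric.cthickening δ (K \ B x))) ∧
      ∀ x ∈ S, ∀ y ∈ S, x ≠ y →
        Disjoint (Metric.cthickening δ (B x)) (Metric.cthickening δ (B y)) := by
    refine Filter.Eventually.and (self_mem_nhdsWithin : Ioi (0 : ℝ) ∈ 𝓝[>] 0)
      (Filter.Eventually.and ?_ ?_)
    · rw [Filter.eventually_all_finset]
      exact fun x hx => hev _ _ (hBc x hx) (hBc' x hx) disjoint_sdiff_right
    · simp only [Filter.eventually_all_finset, Filter.eventually_imp_distrib_left]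
      exact fun x hx y hy hxy => hev _ _ (hBc x hx) (hBc y hy) (hdisj x hx y hy hxy)
  obtain ⟨δ, hδ0, hδ1, hδ2⟩ := hδ.exists
  refine ⟨fun x => Metric.thickening δ (B x), fun x hx => ⟨Metric.isOpen_thickening,
    Metric.self_subset_thickening hδ0 _ (hBmem x hx), disjoint_left.2 fun z hz hzK => ?_⟩,
    fun x hx y hy hxy => (hδ2 x hx y hy hxy).mono (Metric.thickening_subset_cthickening _ _)
      (Metric.thickening_subset_cthickening _ _)⟩
  rw [Metric.isOpen_thickening.frontier_eq] at hz
  by_cases hzB : z ∈ B x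
  · exact hz.2 (Metric.self_subset_thickening hδ0 _ hzB)
  · exact disjoint_left.1 (hδ1 x hx) (Metric.closure_thickening_subset_cthickening _ _ hz.1)
      (Metric.self_subset_cthickening _ ⟨hzK, hzB⟩)

end Topology

section LineDeriv

variable {ι : Type*} [Fintype ι] [DecidableEq ι] {F : ι → (ι → ℝ) → ℝ} {w v : ι → ℝ}

lemma jacobian_mulVec_eq_of_hasDerivAt (hF : ∀ a, Differentiable ℝ (F a)) {a : ι} {y : ℝ}
    (h : HasDerivAt (fun t : ℝ => F a (w + t • v)) y 0) : ((jacobian F w).mulVec v) a = y := by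
  rw [jacobian_mulVec]
  have := ((hF a).differentiableAt (x := w)).hasFDerivAt.hasLineDerivAt v
  exact HasDerivAt.unique this h

lemma eq_zero_of_hasDerivAt_line (hF : ∀ a, Differentiable ℝ (F a)) (hw : (jacobian F w).det ≠ 0)
    (h : ∀ a, HasDerivAt (fun t : ℝ => F a (w + t • v)) 0 0) : v = 0 :=
  Matrix.eq_zero_of_mulVec_eq_zero hw (funext fun a => jacobian_mulVec_eq_of_hasDerivAt hF (h a))

lemma exists_hasDerivAt_line (hF : ∀ a, Differentiable ℝ (F a)) (hw : (jacobian F w).det = 0) :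
    ∃ v ≠ 0, ∀ a, HasDerivAt (fun t : ℝ => F a (w + t • v)) 0 0 := by
  obtain ⟨v, hv, h⟩ := Matrix.exists_mulVec_eq_zero_iff.2 hw
  refine ⟨v, hv, fun a => ?_⟩
  have h1 := ((hF a).differentiableAt (x := w)).hasFDerivAt.hasLineDerivAt v
  rw [← jacobian_mulVec, h] at h1
  exact h1

end LineDeriv

section ExpSum

variable {n k : ℕ} (c₀ : ℝ) (c : Fin n → ℝ) (γ : Fin k → ℝ) (b : Fin k → Fin n → ℝ)

/-- An exponential sum with `n + k + 1` terms, in coordinates where `n` of the exponents are the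
coordinate forms. -/
noncomputable def expSum (u : Fin n → ℝ) : ℝ :=
  c₀ + ∑ i, c i * Real.exp (u i) + ∑ l, γ l * Real.exp (∑ i, b l i * u i)

/-- The `i`-th partial derivative of `expSum`. -/
noncomputable def expSumDeriv (i : Fin n) (u : Fin n → ℝ) : ℝ :=
  c i * Real.exp (u i) + ∑ l, γ l * b l i * Real.exp (∑ i, b l i * u i)

lemma contDiff_expSum {m : WithTop ℕ∞} : ContDiff ℝ m (expSum c₀ c γ b) := by
  unfold expSum
  fun_prop

lemma contDiff_expSumDeriv (i : Fin n) {m : WithTop ℕ∞} : ContDiff ℝ m (expSumDeriv c γ b i) := by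
  unfold expSumDeriv
  fun_prop

lemma fderiv_expSum_single (u : Fin n → ℝ) (i : Fin n) :
    fderiv ℝ (expSum c₀ c γ b) u (Pi.single i 1) = expSumDeriv c γ b i u := by
  have h1 : HasFDerivAt (fun u : Fin n → ℝ => ∑ i, c i * Real.exp (u i))
      (∑ i, c i • (Real.exp (u i) •
        ContinuousLinearMap.proj (R := ℝ) (φ := fun _ : Fin n => ℝ) i)) u :=
    HasFDerivAt.fun_sum fun i _ => ((hasFDerivAt_apply (𝕜 := ℝ) i u).exp).const_mul (c i)
  have h2 : HasFDerivAt (fun u : Fin n → ℝ => ∑ l, γ l * Real.exp (∑ i, b l i * u i))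
      (∑ l, γ l • (Real.exp (∑ i, b l i * u i) •
        ∑ i, b l i • ContinuousLinearMap.proj (R := ℝ) (φ := fun _ : Fin n => ℝ) i)) u :=
    HasFDerivAt.fun_sum fun l _ => (HasFDerivAt.exp (HasFDerivAt.fun_sum fun i _ =>
      (hasFDerivAt_apply (𝕜 := ℝ) i u).const_mul (b l i))).const_mul (γ l)
  have h4 := ((h1.const_add c₀).add h2).fderiv
  change fderiv ℝ (expSum c₀ c γ b) u = _ at h4
  rw [h4]
  simp [Pi.single_apply, expSumDeriv, mul_assoc, mul_comm]

lemma expSum_sub (a : ℝ) (ε u : Fin n → ℝ) :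
    expSum (c₀ - a) (fun i => c i - ε i) γ b u =
      expSum c₀ c γ b u - a - ∑ i, ε i * Real.exp (u i) := by
  simp only [expSum, sub_mul, Finset.sum_sub_distrib]
  ring

lemma expSumDeriv_sub (ε u : Fin n → ℝ) (i : Fin n) :
    expSumDeriv (fun i => c i - ε i) γ b i u = expSumDeriv c γ b i u - ε i * Real.exp (u i) := by
  simp only [expSumDeriv]
  ring

open MvPolynomial in
/-- The equations for the points of a face of the orthant `{u | ∀ i, κ ≤ u i}` at which
`∑ i, u i` is critical on the zero set of `expSum`. -/
noncomputable def facePoly (κ : ℝ) (I : Finset (Fin n)) (i₀ : Fin n) :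
    Fin n ⊕ Fin k → MvPolynomial (Fin n ⊕ Fin k) ℝ :=
  Sum.elim (fun i =>
    if i ∈ I then X (Sum.inl i) - C (Real.exp κ)
    else if i = i₀ then
      C c₀ + ∑ i, C (c i) * X (Sum.inl i) + ∑ l, C (γ l) * X (Sum.inr l)
    else
      (C (c i) * X (Sum.inl i) + ∑ l, C (γ l * b l i) * X (Sum.inr l)) -
      (C (c i₀) * X (Sum.inl i₀) + ∑ l, C (γ l * b l i₀) * X (Sum.inr l))) 0

/-- The point with coordinates `u` and the values of the linear forms `b l` at `u`. -/
def liftPoint (u : Fin n → ℝ) : Fin n ⊕ Fin k → ℝ := Sum.elim u fun l => ∑ i, b l i * u i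

variable {c₀ c γ b} {κ : ℝ} {I : Finset (Fin n)} {i₀ : Fin n}

open MvPolynomial in
lemma nondegBound_facePoly :
    NondegBound (fun a => expRow (facePoly c₀ c γ b κ I i₀ a) (linPart b k a))
      (rolleBound k n n) := by
  have hC : ∀ (r : ℝ) (a : Fin n ⊕ Fin k),
      (C r * X a : MvPolynomial (Fin n ⊕ Fin k) ℝ).totalDegree ≤ 1 :=
    fun r a => (totalDegree_mul _ _).trans (by simp)
  have := nondegBound_expRow_linPart b k n le_rfl rfl (facePoly c₀ c γ b κ I i₀)
    (Sum.elim (fun _ => 1) fun _ => 0) ?_ ?_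
  · convert this
    simp [isLinRow]
  · rintro (i | l)
    · simp only [facePoly, Sum.elim_inl]
      split_ifs
      · exact (totalDegree_sub _ _).trans (by simp)
      · refine (totalDegree_add _ _).trans
          (max_le ((totalDegree_add _ _).trans (max_le (by simp) ?_)) ?_)
        · exact totalDegree_finsetSum_le fun i _ => hC _ _
        · exact totalDegree_finsetSum_le fun i _ => hC _ _
      · refine (totalDegree_sub _ _).trans (max_le ?_ ?_) <;>
          exact (totalDegree_add _ _).trans (max_le (hC _ _)
            (totalDegree_finsetSum_le fun i _ => hC _ _))
    · simp [facePoly]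
  · rintro (i | l)
    · simp [isLinRow]
    · simp

lemma expRow_facePoly_inl_mem {i : Fin n} (hi : i ∈ I) (w : Fin n ⊕ Fin k → ℝ) :
    expRow (facePoly c₀ c γ b κ I i₀ (Sum.inl i)) (linPart b k (Sum.inl i)) w =
      Real.exp (w (Sum.inl i)) - Real.exp κ := by
  simp [expRow, facePoly, linPart, hi]

lemma expRow_facePoly_base (hi : i₀ ∉ I) (u : Fin n → ℝ) :
    expRow (facePoly c₀ c γ b κ I i₀ (Sum.inl i₀)) (linPart b k (Sum.inl i₀)) (liftPoint b u) =
      expSum c₀ c γ b u := by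
  simp [expRow, facePoly, linPart, hi, liftPoint, expSum]

lemma expRow_facePoly_inl {i : Fin n} (hi : i ∉ I) (h : i ≠ i₀) (u : Fin n → ℝ) :
    expRow (facePoly c₀ c γ b κ I i₀ (Sum.inl i)) (linPart b k (Sum.inl i)) (liftPoint b u) =
      expSumDeriv c γ b i u - expSumDeriv c γ b i₀ u := by
  simp [expRow, facePoly, linPart, hi, h, liftPoint, expSumDeriv]

lemma expRow_facePoly_inr (l : Fin k) (w : Fin n ⊕ Fin k → ℝ) :
    expRow (facePoly c₀ c γ b κ I i₀ (Sum.inr l)) (linPart b k (Sum.inr l)) w =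
      w (Sum.inr l) - ∑ i, b l i * w (Sum.inl i) := by
  simp [expRow, facePoly, linPart, linForm, Pi.single_apply]
  ring

end ExpSum

section Genericity

variable {n k : ℕ} (c₀ : ℝ) (c : Fin n → ℝ) (γ : Fin k → ℝ) (b : Fin k → Fin n → ℝ)
  (κ : ℝ) (I : Finset (Fin n))

/-- The point of a face of the orthant determined by the free coordinates of `x`. -/
def facePoint (x : Option (Fin n) → ℝ) : Fin n → ℝ := fun i => if i ∈ I then κ else x (some i)

/-- The map whose regular values are the perturbations for which the critical points on the face
`I` are nondegenerate. The coordinate `none` plays the role of a Lagrange multiplier. -/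
noncomputable def sardMap : Option (Fin n) → (Option (Fin n) → ℝ) → ℝ
  | none => fun x => expSum c₀ c γ b (facePoint κ I x) -
      ∑ i ∈ Iᶜ, (expSumDeriv c γ b i (facePoint κ I x) - x none) -
      ∑ i ∈ I, x (some i) * Real.exp κ
  | some i => fun x => if i ∈ I then x (some i) else
      (expSumDeriv c γ b i (facePoint κ I x) - x none) * Real.exp (-x (some i))

lemma contDiff_facePoint {m : WithTop ℕ∞} : ContDiff ℝ m (facePoint (n := n) κ I) := by
  refine contDiff_pi.2 fun i => ?_
  unfold facePoint
  split_ifs <;> fun_prop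

lemma contDiff_sardMap (a : Option (Fin n)) {m : WithTop ℕ∞} :
    ContDiff ℝ m (sardMap c₀ c γ b κ I a) := by
  have h1 := (contDiff_expSum c₀ c γ b (m := m)).comp (contDiff_facePoint κ I)
  have h2 := fun i => (contDiff_expSumDeriv c γ b i (m := m)).comp (contDiff_facePoint κ I)
  rcases a with _ | i
  · exact (h1.sub (ContDiff.sum fun i _ => (h2 i).sub (contDiff_apply _ _ _))).sub
      (ContDiff.sum fun i _ => (contDiff_apply _ _ _).mul contDiff_const)
  · by_cases hi : i ∈ I
    · simpa only [sardMap, if_pos hi] using contDiff_apply _ _ _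
    · simp only [sardMap, if_neg hi]
      exact ((h2 i).sub (contDiff_apply _ _ _)).mul (contDiff_apply _ _ _).neg.exp

variable {c₀ c γ b κ I} {θ : Option (Fin n) → ℝ}

lemma expSum_const_ne_zero
    (hreg : ∀ x, (∀ a, sardMap c₀ c γ b κ Finset.univ a x = θ a) →
      (jacobian (sardMap c₀ c γ b κ Finset.univ) x).det ≠ 0) :
    expSum (c₀ - θ none) (fun i => c i - θ (some i)) γ b (fun _ => κ) ≠ 0 := by
  intro h
  rw [expSum_sub] at h
  let x : Option (Fin n) → ℝ := fun a => a.elim 0 fun i => θ (some i)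
  have hface : ∀ x, facePoint κ Finset.univ x = fun _ : Fin n => κ := fun x => by
    funext i; simp [facePoint]
  have hx : ∀ a, sardMap c₀ c γ b κ Finset.univ a x = θ a := by
    rintro (_ | i)
    · simp only [sardMap, hface, Finset.compl_univ, Finset.sum_empty, x, Option.elim]
      linarith
    · simp [sardMap, x]
  have := eq_zero_of_hasDerivAt_line (v := Pi.single none 1)
    (fun a => (contDiff_sardMap c₀ c γ b κ Finset.univ a (m := 1)).differentiable one_ne_zero)
    (hreg x hx) ?_
  · exact one_ne_zero (α := ℝ) (by simpa using congrFun this none)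
  · rintro (_ | i)
    · simpa [sardMap, hface] using hasDerivAt_const (0 : ℝ) _
    · simpa [sardMap] using hasDerivAt_const (0 : ℝ) _

lemma isNondegZero_facePoly {i₀ : Fin n}
    (hreg : ∀ x, (∀ a, sardMap c₀ c γ b κ I a x = θ a) →
      (jacobian (sardMap c₀ c γ b κ I) x).det ≠ 0)
    {u : Fin n → ℝ} (hu : ∀ i ∈ I, u i = κ) {s : ℝ}
    (hs : ∀ i ∉ I, expSumDeriv (fun i => c i - θ (some i)) γ b i u = s) (hi₀ : i₀ ∉ I)
    (h0 : expSum (c₀ - θ none) (fun i => c i - θ (some i)) γ b u = 0) :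
    IsNondegZero (fun a => expRow (facePoly (c₀ - θ none) (fun i => c i - θ (some i)) γ b κ I i₀ a)
      (linPart b k a)) (liftPoint b u) := by
  refine ⟨?_, fun hdet => ?_⟩
  · rintro (i | l) <;> beta_reduce
    · by_cases hi : i ∈ I
      · rw [expRow_facePoly_inl_mem hi, liftPoint, Sum.elim_inl, hu i hi, sub_self]
      · rcases eq_or_ne i i₀ with rfl | h
        · rw [expRow_facePoly_base hi, h0]
        · rw [expRow_facePoly_inl hi h, hs i hi, hs i₀ hi₀, sub_self]
    · rw [expRow_facePoly_inr, liftPoint, Sum.elim_inr]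
      simp
  obtain ⟨v, hv, hline⟩ := exists_hasDerivAt_line
    (fun a => (contDiff_expRow _ _ (m := 1)).differentiable one_ne_zero) hdet
  let du : Fin n → ℝ := fun i => v (Sum.inl i)
  have hvr : ∀ l, v (Sum.inr l) = ∑ i, b l i * du i := by
    intro l
    have h1 := hline (Sum.inr l)
    simp only [expRow_facePoly_inr] at h1
    have h2 : HasDerivAt (fun t : ℝ => (liftPoint b u + t • v) (Sum.inr l) -
        ∑ i, b l i * (liftPoint b u + t • v) (Sum.inl i))
        (v (Sum.inr l) - ∑ i, b l i * du i) 0 := by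
      have : (fun t : ℝ => (liftPoint b u + t • v) (Sum.inr l) -
        ∑ i, b l i * (liftPoint b u + t • v) (Sum.inl i)) =
          fun t : ℝ => t * (v (Sum.inr l) - ∑ i, b l i * du i) := by
        funext t
        simp only [liftPoint, Pi.add_apply, Pi.smul_apply, Sum.elim_inr, Sum.elim_inl, smul_eq_mul,
          mul_add, Finset.sum_add_distrib, mul_sub, Finset.mul_sum, du]
        have : ∀ i, b l i * (t * v (Sum.inl i)) = t * (b l i * v (Sum.inl i)) := fun i => by ring
        simp only [this]
        ring
      rw [this]
      simpa using (hasDerivAt_id (0 : ℝ)).mul_const (v (Sum.inr l) - ∑ i, b l i * du i)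
    linarith [h1.unique h2]
  have hlift : ∀ t : ℝ, liftPoint b u + t • v = liftPoint b (u + t • du) := by
    intro t
    funext a
    rcases a with i | l
    · simp [liftPoint, du]
    · simp only [liftPoint, Pi.add_apply, Pi.smul_apply, Sum.elim_inr, smul_eq_mul, hvr,
        mul_add, Finset.sum_add_distrib, Finset.mul_sum]
      exact congrArg _ (Finset.sum_congr rfl fun i _ => by ring)
  have hdu : ∀ i ∈ I, du i = 0 := by
    intro i hi
    have h1 := hline (Sum.inl i)
    simp only [expRow_facePoly_inl_mem hi] at h1
    have h2 : HasDerivAt (fun t : ℝ => Real.exp ((liftPoint b u + t • v) (Sum.inl i)) - Real.exp κ)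
        (Real.exp (u i + 0 * v (Sum.inl i)) * v (Sum.inl i)) 0 := by
      have := ((hasDerivAt_mul_const (x := (0 : ℝ)) (v (Sum.inl i))).const_add (u i)).exp
      exact this.sub_const _
    have h3 := h1.unique h2
    exact (mul_eq_zero.1 h3.symm).resolve_left (Real.exp_pos _).ne'
  set c' : Fin n → ℝ := fun i => c i - θ (some i)
  have hd0 : HasDerivAt (fun t : ℝ => expSum (c₀ - θ none) c' γ b (u + t • du)) 0 0 := by
    have h1 := hline (Sum.inl i₀)
    simpa only [hlift, expRow_facePoly_base hi₀] using h1
  obtain ⟨σ, hσ⟩ : ∃ σ, HasDerivAt (fun t : ℝ => expSumDeriv c' γ b i₀ (u + t • du)) σ 0 :=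
    ⟨_, (((contDiff_expSumDeriv c' γ b i₀ (m := 1)).differentiable one_ne_zero).differentiableAt
      (x := u)).hasFDerivAt.hasLineDerivAt du⟩
  have hdi : ∀ i ∉ I, HasDerivAt (fun t : ℝ => expSumDeriv c' γ b i (u + t • du)) σ 0 := by
    intro i hi
    rcases eq_or_ne i i₀ with rfl | h
    · exact hσ
    · have h1 := hline (Sum.inl i)
      simp only [hlift, expRow_facePoly_inl hi h] at h1
      simpa using h1.fun_add hσ
  let x : Option (Fin n) → ℝ := fun a => a.elim s fun i => if i ∈ I then θ (some i) else u i
  let dx : Option (Fin n) → ℝ := fun a => a.elim σ du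
  have hface : ∀ t : ℝ, facePoint κ I (x + t • dx) = u + t • du := by
    intro t
    funext i
    by_cases hi : i ∈ I
    · simp [facePoint, hi, hu, hdu]
    · simp [facePoint, hi, x, dx]
  have hsome : ∀ i ∉ I, ∀ t : ℝ, sardMap c₀ c γ b κ I (some i) (x + t • dx) =
      (expSumDeriv c' γ b i (u + t • du) - (s + t * σ)) * Real.exp (-(u i + t * du i)) +
        θ (some i) := by
    intro i hi t
    have h1 : (x + t • dx) (some i) = u i + t * du i := by simp [x, dx, hi]
    have h2 : (x + t • dx) none = s + t * σ := by simp [x, dx]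
    simp only [sardMap, if_neg hi, hface, h1, h2, c', expSumDeriv_sub]
    have h3 : (u + t • du) i = u i + t * du i := by simp
    have h4 : Real.exp (u i + t * du i) * Real.exp (-(u i + t * du i)) = 1 := by
      rw [← Real.exp_add]; simp
    rw [h3]
    linear_combination θ (some i) * h4
  have hsomeI : ∀ i ∈ I, ∀ t : ℝ, sardMap c₀ c γ b κ I (some i) (x + t • dx) = θ (some i) := by
    intro i hi t
    simp [sardMap, hi, x, dx, hdu]
  have hnone : ∀ t : ℝ, sardMap c₀ c γ b κ I none (x + t • dx) =
      expSum (c₀ - θ none) c' γ b (u + t • du) -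
        ∑ i ∈ Iᶜ, (expSumDeriv c' γ b i (u + t • du) - (s + t * σ)) + θ none := by
    intro t
    have h2 : (x + t • dx) none = s + t * σ := by simp [x, dx]
    have h3 : ∀ i ∈ I, (x + t • dx) (some i) * Real.exp κ =
        θ (some i) * Real.exp ((u + t • du) i) := by
      intro i hi
      simp [x, dx, hi, hu, hdu]
    simp only [sardMap, hface, h2, c', expSumDeriv_sub, expSum_sub, Finset.sum_congr rfl h3]
    rw [← Finset.sum_compl_add_sum I fun i => θ (some i) * Real.exp ((u + t • du) i)]
    simp only [Finset.sum_sub_distrib]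
    ring
  have hx : ∀ a, sardMap c₀ c γ b κ I a x = θ a := by
    have hx0 : x = x + (0 : ℝ) • dx := by simp
    rintro (_ | i)
    · rw [hx0, hnone, zero_smul, add_zero, h0, zero_mul, add_zero,
        Finset.sum_eq_zero fun i hi => by rw [hs i (Finset.mem_compl.1 hi), sub_self]]
      ring
    · by_cases hi : i ∈ I
      · rw [hx0, hsomeI i hi]
      · rw [hx0, hsome i hi, zero_smul, add_zero, hs i hi]
        ring
  have hst : HasDerivAt (fun t : ℝ => s + t * σ) σ 0 :=
    (hasDerivAt_mul_const (x := (0 : ℝ)) σ).const_add s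
  have hdx : dx = 0 := by
    refine eq_zero_of_hasDerivAt_line
      (fun a => (contDiff_sardMap c₀ c γ b κ I a (m := 1)).differentiable one_ne_zero)
      (hreg x hx) ?_
    rintro (_ | i)
    · simp only [hnone]
      have := (hd0.sub (HasDerivAt.fun_sum (u := Iᶜ) fun i hi =>
        (hdi i (Finset.mem_compl.1 hi)).sub hst)).add_const (θ none)
      simpa using this
    · by_cases hi : i ∈ I
      · simp only [hsomeI i hi]
        exact hasDerivAt_const _ _
      · simp only [hsome i hi]
        have := (((hdi i hi).sub hst).mul
          (((hasDerivAt_mul_const (x := (0 : ℝ)) (du i)).const_add (u i)).neg.exp)).add_const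
            (θ (some i))
        refine this.congr_deriv ?_
        simp [hs i hi]
  refine hv (funext fun a => ?_)
  have hdu0 : ∀ i, du i = 0 := fun i => congrFun hdx (some i)
  rcases a with i | l
  · exact hdu0 i
  · rw [hvr]; simp [hdu0]

end Genericity

section Counting

variable {n k : ℕ} {c₀ : ℝ} {c : Fin n → ℝ} {γ : Fin k → ℝ} {b : Fin k → Fin n → ℝ} {κ : ℝ}

lemma card_zeros_edge_le (hκ : expSum c₀ c γ b (fun _ => κ) ≠ 0) (i₀ : Fin n)
    (M : Finset (Fin n → ℝ)) (hM : ∀ u ∈ M, expSum c₀ c γ b u = 0 ∧ ∀ i ≠ i₀, u i = κ) :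
    M.card ≤ k + 1 := by
  classical
  let γ' : Option (Option (Fin k)) → ℝ
    | none => c₀ + ∑ i ∈ Finset.univ.erase i₀, c i * Real.exp κ
    | some none => c i₀
    | some (some l) => γ l * Real.exp (∑ i ∈ Finset.univ.erase i₀, b l i * κ)
  let β' : Option (Option (Fin k)) → ℝ
    | none => 0
    | some none => 1
    | some (some l) => b l i₀
  have hsum : ∀ u : Fin n → ℝ, (∀ i ≠ i₀, u i = κ) →
      ∑ a, γ' a * Real.exp (β' a * u i₀) = expSum c₀ c γ b u := by
    intro u hu
    have h1 : ∑ i, c i * Real.exp (u i) =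
        ∑ i ∈ Finset.univ.erase i₀, c i * Real.exp κ + c i₀ * Real.exp (u i₀) := by
      rw [← Finset.sum_erase_add _ _ (Finset.mem_univ i₀)]
      congr 1
      exact Finset.sum_congr rfl fun i hi => by rw [hu i (Finset.ne_of_mem_erase hi)]
    have h2 : ∀ l, Real.exp (∑ i, b l i * u i) =
        Real.exp (∑ i ∈ Finset.univ.erase i₀, b l i * κ) * Real.exp (b l i₀ * u i₀) := by
      intro l
      rw [← Real.exp_add, ← Finset.sum_erase_add _ _ (Finset.mem_univ i₀)]
      congr 2
      exact Finset.sum_congr rfl fun i hi => by rw [hu i (Finset.ne_of_mem_erase hi)]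
    simp only [expSum, h1, h2, Fintype.sum_option, γ', β', zero_mul, Real.exp_zero, mul_one,
      one_mul, mul_assoc]
    ring
  have hinj : Set.InjOn (fun u : Fin n → ℝ => u i₀) M := fun u hu v hv h => funext fun i => by
    rcases eq_or_ne i i₀ with rfl | hi
    · exact h
    · rw [(hM u hu).2 i hi, (hM v hv).2 i hi]
  have := card_zeros_expSum_lt Finset.univ γ' β' κ (by
    rw [← hsum (fun _ => κ) fun _ _ => rfl] at hκ; exact hκ)
    (M.image fun u => u i₀) (fun t ht => by
      obtain ⟨u, hu, rfl⟩ := Finset.mem_image.1 ht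
      rw [hsum u (hM u hu).2, (hM u hu).1])
  rw [Finset.card_image_of_injOn hinj] at this
  simp only [Finset.card_univ, Fintype.card_option, Fintype.card_fin] at this
  omega

lemma sum_powerset_weight (n : ℕ) (A T : ℝ) :
    ∑ J : Finset (Fin n), (if J.card = 0 then 0 else if J.card = 1 then A else T) =
      n * A + (2 ^ n - 1 - n) * T := by
  have h : ∀ J : Finset (Fin n), (if J.card = 0 then 0 else if J.card = 1 then A else T) =
      T - (if J.card = 0 then T else 0) + if J.card = 1 then A - T else 0 := by
    intro J
    split_ifs <;> first | omega | ring
  have h0 : (Finset.univ.filter fun J : Finset (Fin n) => J.card = 0).card = 1 := by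
    simp [Finset.filter_eq']
  have h1 : (Finset.univ.filter fun J : Finset (Fin n) => J.card = 1).card = n := by
    have := Finset.card_powersetCard 1 (Finset.univ : Finset (Fin n))
    rw [Finset.powersetCard_eq_filter, Finset.powerset_univ, Finset.card_univ, Fintype.card_fin,
      Nat.choose_one_right] at this
    exact this
  simp only [h, Finset.sum_add_distrib, Finset.sum_sub_distrib, ← Finset.sum_filter,
    Finset.sum_const, h0, h1, Finset.card_univ, Fintype.card_finset, Fintype.card_fin, nsmul_eq_mul]
  push_cast
  ring

lemma card_critical_le {θ : Option (Fin n) → ℝ}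
    (hreg : ∀ I x, (∀ a, sardMap c₀ c γ b κ I a x = θ a) →
      (jacobian (sardMap c₀ c γ b κ I) x).det ≠ 0)
    (M : Finset (Fin n → ℝ))
    (hM : ∀ u ∈ M, expSum (c₀ - θ none) (fun i => c i - θ (some i)) γ b u = 0 ∧
      ∃ I : Finset (Fin n), I ≠ Finset.univ ∧ (∀ i ∈ I, u i = κ) ∧
        ∃ s, ∀ i ∉ I, expSumDeriv (fun i => c i - θ (some i)) γ b i u = s) :
    (M.card : ℝ) ≤ n * (k + 1) + (2 ^ n - 1 - n) * rolleBound k n n := by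
  classical
  choose! h0 I hIu hI s hs using hM
  rw [Finset.card_eq_sum_card_fiberwise (f := fun u => (I u)ᶜ) (t := Finset.univ)
    (fun _ _ => Finset.mem_univ _), Nat.cast_sum, ← sum_powerset_weight]
  refine Finset.sum_le_sum fun J _ => ?_
  have hfib : ∀ u ∈ M.filter fun u => (I u)ᶜ = J, u ∈ M ∧ I u = Jᶜ := fun u hu => by
    obtain ⟨h1, h2⟩ := Finset.mem_filter.1 hu
    exact ⟨h1, by rw [← h2, compl_compl]⟩
  split_ifs with hJ0 hJ1
  · rw [Finset.card_eq_zero] at hJ0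
    rw [Finset.eq_empty_of_forall_notMem (s := M.filter fun u => (I u)ᶜ = J) fun u hu => ?_]
    · simp
    · obtain ⟨h1, h2⟩ := hfib u hu
      exact hIu u h1 (by rw [h2, hJ0, Finset.compl_empty])
  · obtain ⟨i₀, rfl⟩ := Finset.card_eq_one.1 hJ1
    have := card_zeros_edge_le (expSum_const_ne_zero (hreg _)) i₀ _ fun u hu =>
      ⟨h0 u (hfib u hu).1, fun i hi => hI u (hfib u hu).1 i (by rw [(hfib u hu).2]; simpa using hi)⟩
    exact_mod_cast this
  · obtain ⟨i₀, hi₀⟩ := Finset.card_pos.1 (Nat.pos_of_ne_zero hJ0)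
    have hinj : Function.Injective (liftPoint b) := fun u v h =>
      funext fun i => congrFun h (Sum.inl i)
    rw [← Finset.card_image_of_injective _ hinj]
    refine nondegBound_facePoly (c₀ := c₀ - θ none) (c := fun i => c i - θ (some i)) (γ := γ)
      (b := b) (I := Jᶜ) (i₀ := i₀) (κ := κ) _ fun w hw => ?_
    obtain ⟨u, hu, rfl⟩ := Finset.mem_image.1 hw
    obtain ⟨h1, h2⟩ := hfib u hu
    exact isNondegZero_facePoly (hreg _) (fun i hi => hI u h1 i (by rwa [h2]))
      (s := s u) (fun i hi => hs u h1 i (by rwa [h2])) (by simpa using hi₀) (h0 u h1)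

lemma exists_face_of_local_min (hκ : expSum c₀ c γ b (fun _ => κ) ≠ 0) {m : Fin n → ℝ}
    (hm : ∀ i, κ ≤ m i) (h0 : expSum c₀ c γ b m = 0)
    (hmin : ∀ᶠ u in 𝓝 m, (∀ i, κ ≤ u i) → expSum c₀ c γ b u = 0 → ∑ i, m i ≤ ∑ i, u i) :
    ∃ I : Finset (Fin n), I ≠ Finset.univ ∧ (∀ i ∈ I, m i = κ) ∧
      ∃ s, ∀ i ∉ I, expSumDeriv c γ b i m = s := by
  classical
  let I : Finset (Fin n) := Finset.univ.filter fun i => m i = κ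
  have hI : ∀ i, i ∈ I ↔ m i = κ := fun i => by simp [I]
  have hIu : I ≠ Finset.univ := fun h => hκ (by
    rw [← h0]
    congr 1
    funext i
    exact ((hI i).1 (h ▸ Finset.mem_univ i)).symm)
  refine ⟨I, hIu, fun i hi => (hI i).1 hi, ?_⟩
  let f : Option I → (Fin n → ℝ) → ℝ := fun a => a.elim (expSum c₀ c γ b) fun i u => u i
  let f' : Option I → (Fin n → ℝ) →L[ℝ] ℝ := fun a =>
    a.elim (fderiv ℝ (expSum c₀ c γ b) m) fun i => ContinuousLinearMap.proj i.1
  have hf : ∀ a, HasStrictFDerivAt (f a) (f' a) m := by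
    rintro (_ | i)
    · exact (contDiff_expSum c₀ c γ b (m := 1)).contDiffAt.hasStrictFDerivAt one_ne_zero
    · exact (ContinuousLinearMap.proj (R := ℝ) (φ := fun _ : Fin n => ℝ) i.1).hasStrictFDerivAt
  have hφ : HasStrictFDerivAt (fun u : Fin n → ℝ => ∑ i, u i)
      (∑ i, ContinuousLinearMap.proj (R := ℝ) (φ := fun _ : Fin n => ℝ) i) m :=
    HasStrictFDerivAt.fun_sum fun i _ =>
      (ContinuousLinearMap.proj (R := ℝ) (φ := fun _ : Fin n => ℝ) i).hasStrictFDerivAt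
  have hloc : IsLocalExtrOn (fun u : Fin n → ℝ => ∑ i, u i) {u | ∀ a, f a u = f a m} m := by
    refine Or.inl ?_
    have hpos : ∀ᶠ u in 𝓝 m, ∀ i, i ∉ I → κ ≤ u i := by
      rw [eventually_all]
      intro i
      by_cases hi : i ∈ I
      · exact Eventually.of_forall fun _ h => absurd hi h
      · have : κ < m i := lt_of_le_of_ne (hm i) fun h => hi ((hI i).2 h.symm)
        filter_upwards [(continuous_apply i).continuousAt.eventually (lt_mem_nhds this)] with u hu _
        exact hu.le
    filter_upwards [mem_nhdsWithin_of_mem_nhds hmin, mem_nhdsWithin_of_mem_nhds hpos,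
      self_mem_nhdsWithin] with u h1 h2 h3
    refine h1 (fun i => ?_) ((h3 none).trans h0)
    by_cases hi : i ∈ I
    · exact (((h3 (some ⟨i, hi⟩)).trans ((hI i).1 hi)).symm).le
    · exact h2 i hi
  obtain ⟨Λ, Λ₀, hne, hΛ⟩ := hloc.exists_multipliers_of_hasStrictFDerivAt hf hφ
  have hj : ∀ j, Λ none * expSumDeriv c γ b j m +
      (∑ i : I, Λ (some i) * (Pi.single j (1 : ℝ) : Fin n → ℝ) i) + Λ₀ = 0 := by
    intro j
    have := congrArg (fun L => L (Pi.single j (1 : ℝ))) hΛ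
    simpa [Fintype.sum_option, f', fderiv_expSum_single, Pi.single_apply] using this
  have hjI : ∀ j ∉ I, Λ none * expSumDeriv c γ b j m + Λ₀ = 0 := by
    intro j hjn
    have := hj j
    rw [Finset.sum_eq_zero fun i _ => ?_, add_zero] at this
    · exact this
    · rw [Pi.single_eq_of_ne (fun h : (i : Fin n) = j => hjn (h ▸ i.2)), mul_zero]
  have hΛn : Λ none ≠ 0 := by
    intro h
    obtain ⟨j₀, hj₀⟩ : ∃ j, j ∉ I := by
      by_contra! h'
      exact hIu (Finset.eq_univ_iff_forall.2 h')
    have hΛ₀ : Λ₀ = 0 := by simpa [h] using hjI j₀ hj₀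
    refine hne (Prod.ext (funext fun a => ?_) hΛ₀)
    rcases a with _ | i
    · exact h
    · have := hj i
      rw [h, hΛ₀, zero_mul, zero_add, add_zero, Finset.sum_eq_single i] at this
      · simpa using this
      · intro l _ hl
        rw [Pi.single_eq_of_ne (fun h => hl (Subtype.ext h)), mul_zero]
      · simp
  refine ⟨-Λ₀ / Λ none, fun i hi => ?_⟩
  rw [eq_div_iff hΛn]
  linarith [hjI i hi]

end Counting

section Perturbation

variable {n k : ℕ} (c₀ : ℝ) (c : Fin n → ℝ) (γ : Fin k → ℝ) (b : Fin k → Fin n → ℝ)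

lemma continuous_expSum_perturbed : Continuous fun p : (Option (Fin n) → ℝ) × (Fin n → ℝ) =>
    expSum (c₀ - p.1 none) (fun i => c i - p.1 (some i)) γ b p.2 := by
  unfold expSum
  fun_prop

variable {c₀ c γ b}

lemma eventually_exists_zero {q : Fin n → ℝ} (h0 : expSum c₀ c γ b q = 0)
    (h1 : ∃ i, expSumDeriv c γ b i q ≠ 0) {U : Set (Fin n → ℝ)} (hU : U ∈ 𝓝 q) :
    ∀ᶠ θ in 𝓝 (0 : Option (Fin n) → ℝ), ∃ z ∈ U,
      expSum (c₀ - θ none) (fun i => c i - θ (some i)) γ b z = 0 := by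
  obtain ⟨i, hi⟩ := h1
  have hs := (contDiff_expSum c₀ c γ b (m := 1)).contDiffAt.hasStrictFDerivAt
    (x := q) one_ne_zero
  have hsurj : (fderiv ℝ (expSum c₀ c γ b) q).range = ⊤ := by
    refine LinearMap.range_eq_top.2 fun y => ⟨(y / expSumDeriv c γ b i q) • Pi.single i 1, ?_⟩
    simp [fderiv_expSum_single, hi]
  have hmap := hs.map_nhds_eq_of_surj hsurj
  obtain ⟨r, hr, hrU⟩ := Metric.mem_nhds_iff.1 hU
  have himg : expSum c₀ c γ b '' Metric.ball q r ∈ 𝓝 (0 : ℝ) := by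
    rw [← h0, ← hmap]
    exact image_mem_map (Metric.ball_mem_nhds q hr)
  obtain ⟨δ, hδ, hδi⟩ := Metric.mem_nhds_iff.1 himg
  obtain ⟨p₁, hp₁, hp₁'⟩ := hδi (show δ / 2 ∈ Metric.ball 0 δ by
    simp [abs_of_pos hδ]; linarith)
  obtain ⟨p₂, hp₂, hp₂'⟩ := hδi (show -(δ / 2) ∈ Metric.ball 0 δ by
    simp [abs_of_pos hδ]; linarith)
  have hcont := continuous_expSum_perturbed c₀ c γ b
  have hc : ∀ p, ContinuousAt (fun θ : Option (Fin n) → ℝ =>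
      expSum (c₀ - θ none) (fun i => c i - θ (some i)) γ b p) 0 := fun p =>
    (hcont.comp (Continuous.prodMk_left p)).continuousAt
  have hz : ∀ p, expSum (c₀ - (0 : Option (Fin n) → ℝ) none)
      (fun i => c i - (0 : Option (Fin n) → ℝ) (some i)) γ b p = expSum c₀ c γ b p := by simp
  have e₁ := (hc p₁).eventually (lt_mem_nhds (a := 0)
    ((half_pos hδ).trans_eq (hp₁'.symm.trans (hz p₁).symm)))
  have e₂ := (hc p₂).eventually (gt_mem_nhds
    (((hz p₂).trans hp₂').trans_lt (neg_neg_of_pos (half_pos hδ))))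
  filter_upwards [e₁, e₂] with θ h₁ h₂
  obtain ⟨z, hz, hz0⟩ := (convex_ball q r).isPreconnected.intermediate_value hp₂ hp₁
    (contDiff_expSum (c₀ - θ none) (fun i => c i - θ (some i)) γ b (m := 0)).continuous.continuousOn
    ⟨h₂.le, h₁.le⟩
  exact ⟨z, hrU hz, hz0⟩

lemma eventually_forall_ne_zero {K : Set (Fin n → ℝ)} (hK : IsCompact K)
    (h : ∀ u ∈ K, expSum c₀ c γ b u ≠ 0) :
    ∀ᶠ θ in 𝓝 (0 : Option (Fin n) → ℝ), ∀ u ∈ K,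
      expSum (c₀ - θ none) (fun i => c i - θ (some i)) γ b u ≠ 0 := by
  refine hK.eventually_forall_of_forall_eventually fun u hu => ?_
  refine (continuous_expSum_perturbed c₀ c γ b).continuousAt.eventually
    (isOpen_ne.mem_nhds ?_)
  simpa using h u hu

/-- The bound for the number of components containing a nondegenerate point of the zero set of an
exponential sum. -/
theorem card_le_of_connectedComponentIn_ne (S : Finset (Fin n → ℝ))
    (hS : ∀ q ∈ S, expSum c₀ c γ b q = 0 ∧ ∃ i, expSumDeriv c γ b i q ≠ 0)
    (hne : ∀ p ∈ S, ∀ q ∈ S, p ≠ q →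
      connectedComponentIn {u | expSum c₀ c γ b u = 0} p ≠
        connectedComponentIn {u | expSum c₀ c γ b u = 0} q) :
    (S.card : ℝ) ≤ n * (k + 1) + (2 ^ n - 1 - n) * rolleBound k n n := by
  classical
  obtain ⟨κ, hκ⟩ : ∃ κ : ℝ, ∀ q ∈ S, ∀ i, κ < q i := by
    have : ∀ᶠ κ : ℝ in atBot, ∀ q ∈ S, ∀ i, κ < q i := by
      simp only [Filter.eventually_all_finset, eventually_all]
      exact fun q _ i => eventually_lt_atBot (q i)
    exact this.exists
  obtain ⟨R, hR⟩ : ∃ R : ℝ, ∀ q ∈ S, ∑ i, q i < R := by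
    have : ∀ᶠ R : ℝ in atTop, ∀ q ∈ S, ∑ i, q i < R := by
      simp only [Filter.eventually_all_finset]
      exact fun q _ => eventually_gt_atTop _
    exact this.exists
  set Y : Set (Fin n → ℝ) := {u | expSum c₀ c γ b u = 0}
  have hsumc : Continuous fun u : Fin n → ℝ => ∑ i, u i := by fun_prop
  let Q : Set (Fin n → ℝ) := {u | (∀ i, κ ≤ u i) ∧ ∑ i, u i ≤ R}
  have hQc : IsCompact Q := by
    refine (isCompact_Icc (a := fun _ : Fin n => κ)
      (b := fun _ => R - n * κ + κ)).of_isClosed_subset ?_ fun u hu => ⟨hu.1, fun i => ?_⟩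
    · refine IsClosed.inter ?_ (isClosed_le hsumc continuous_const)
      exact isClosed_Ici (a := fun _ : Fin n => κ)
    · have h1 := Finset.single_le_sum (f := fun i => u i - κ)
        (fun i _ => sub_nonneg.2 (hu.1 i)) (Finset.mem_univ i)
      simp only [Finset.sum_sub_distrib, Finset.sum_const, Finset.card_univ, Fintype.card_fin,
        nsmul_eq_mul] at h1
      linarith [hu.2]
  have hint : IsOpen {u : Fin n → ℝ | (∀ i, κ < u i) ∧ ∑ i, u i < R} := by
    rw [show {u : Fin n → ℝ | (∀ i, κ < u i) ∧ ∑ i, u i < R} =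
      (⋂ i, {u | κ < u i}) ∩ {u | ∑ i, u i < R} by ext; simp]
    refine IsOpen.inter ?_ (isOpen_lt hsumc continuous_const)
    exact isOpen_iInter_of_finite fun i => isOpen_lt continuous_const (continuous_apply i)
  have hYc : IsClosed Y :=
    isClosed_eq (contDiff_expSum c₀ c γ b (m := 0)).continuous continuous_const
  obtain ⟨W, hW, hWd⟩ := exists_open_separation (Y := Y) (hQc.inter_left hYc) inter_subset_left S
    (fun q hq => ⟨(hS q hq).1, fun i => (hκ q hq i).le, (hR q hq).le⟩) hne
  have e₁ : ∀ᶠ θ in 𝓝 (0 : Option (Fin n) → ℝ), ∀ q ∈ S,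
      ∃ z ∈ W q ∩ {u : Fin n → ℝ | (∀ i, κ < u i) ∧ ∑ i, u i < R},
        expSum (c₀ - θ none) (fun i => c i - θ (some i)) γ b z = 0 := by
    rw [Filter.eventually_all_finset]
    exact fun q hq => eventually_exists_zero (hS q hq).1 (hS q hq).2
      (((hW q hq).1.inter hint).mem_nhds ⟨(hW q hq).2.1, hκ q hq, hR q hq⟩)
  have e₂ : ∀ᶠ θ in 𝓝 (0 : Option (Fin n) → ℝ), ∀ q ∈ S, ∀ u ∈ Q ∩ frontier (W q),
      expSum (c₀ - θ none) (fun i => c i - θ (some i)) γ b u ≠ 0 := by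
    rw [Filter.eventually_all_finset]
    exact fun q hq => eventually_forall_ne_zero (hQc.inter_right isClosed_frontier)
      fun u hu h => disjoint_left.1 (hW q hq).2.2 hu.2 ⟨h, hu.1⟩
  have e₃ : ∀ᵐ θ : Option (Fin n) → ℝ, ∀ I x, (∀ a, sardMap c₀ c γ b κ I a x = θ a) →
      (jacobian (sardMap c₀ c γ b κ I) x).det ≠ 0 :=
    ae_all_iff.2 fun I => ae_forall_det_jacobian_ne_zero fun a =>
      (contDiff_sardMap c₀ c γ b κ I a (m := 1)).differentiable one_ne_zero
  obtain ⟨θ, hreg, hθ₁, hθ₂⟩ := (Measure.dense_of_ae e₃).inter_nhds_nonempty (e₁.and e₂)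
  set g := expSum (c₀ - θ none) (fun i => c i - θ (some i)) γ b
  have hgc : Continuous g := (contDiff_expSum _ _ γ b (m := 0)).continuous
  have hmin : ∀ q, ∃ m, q ∈ S → m ∈ W q ∧ m ∈ Q ∧ g m = 0 ∧ ∑ i, m i < R ∧
      ∀ u ∈ W q, u ∈ Q → g u = 0 → ∑ i, m i ≤ ∑ i, u i := by
    intro q
    by_cases hq : q ∈ S
    swap
    · exact ⟨0, fun h => absurd h hq⟩
    obtain ⟨z, ⟨hzW, hzκ, hzR⟩, hz0⟩ := hθ₁ q hq
    have hcomp : IsCompact (Q ∩ (closure (W q) ∩ {u | g u = 0})) :=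
      hQc.inter_right (isClosed_closure.inter (isClosed_eq hgc continuous_const))
    have hzmem : z ∈ Q ∩ (closure (W q) ∩ {u | g u = 0}) :=
      ⟨⟨fun i => (hzκ i).le, hzR.le⟩, subset_closure hzW, hz0⟩
    obtain ⟨m, ⟨hmQ, hmW, hm0⟩, hm⟩ := hcomp.exists_isMinOn ⟨z, hzmem⟩ hsumc.continuousOn
    refine ⟨m, fun _ => ⟨?_, hmQ, hm0, (hm hzmem).trans_lt hzR, fun u huW huQ hu0 =>
      hm ⟨huQ, subset_closure huW, hu0⟩⟩⟩
    by_contra hmW'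
    refine hθ₂ q hq m ⟨hmQ, ?_⟩ hm0
    rw [(hW q hq).1.frontier_eq]
    exact ⟨hmW, hmW'⟩
  choose m hm using hmin
  have hinj : Set.InjOn m S := fun p hp q hq hpq => by
    by_contra h
    exact disjoint_left.1 (hWd p hp q hq h) (hm p hp).1 (hpq ▸ (hm q hq).1)
  rw [← Finset.card_image_of_injOn hinj]
  refine card_critical_le hreg _ fun u hu => ?_
  obtain ⟨q, hq, rfl⟩ := Finset.mem_image.1 hu
  obtain ⟨h1, h2, h3, h4, h5⟩ := hm q hq
  refine ⟨h3, exists_face_of_local_min (expSum_const_ne_zero (hreg _)) h2.1 h3 ?_⟩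
  filter_upwards [(hW q hq).1.mem_nhds h1, hsumc.continuousAt.eventually (gt_mem_nhds h4)]
    with u hu1 hu2 hu3 hu4
  exact h5 u hu1 ⟨hu3, hu2.le⟩ hu4

end Perturbation

lemma rolleBound_le {c : ℝ} (hc : 5 ≤ c) {D₀ : ℕ} (hD₀ : 1 ≤ D₀)
    (hstep : ∀ m D : ℝ, 0 ≤ m → m ≤ D → (D₀ : ℝ) ≤ D →
      (m + 2) * (D + 1) * (D + m + c + 2) ≤ 4 * D ^ 2 * (m + c - 1)) (j : ℕ) :
    ∀ m D : ℕ, m ≤ D → D₀ ≤ D →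
      rolleBound (j + 2) m D ≤ 2 ^ (j + 2).choose 2 * (D : ℝ) ^ (j + 1) * (D + m + c) := by
  induction j with
  | zero =>
    intro m D hmD hD
    have h1 : (1 : ℝ) ≤ D := by exact_mod_cast hD₀.trans hD
    have h2 : (m : ℝ) ≤ D := by exact_mod_cast hmD
    have h3 : (0 : ℝ) ≤ m := by positivity
    simp only [rolleBound, zero_add, Nat.choose_self, pow_one]
    push_cast
    nlinarith [mul_nonneg h3 (sub_nonneg.2 h2), mul_nonneg h3 (sub_nonneg.2 h1),
      mul_nonneg (sub_nonneg.2 h1) (sub_nonneg.2 hc), mul_nonneg h3 h3]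
  | succ j ih =>
    intro m D hmD hD
    have h1 : (1 : ℝ) ≤ D := by exact_mod_cast hD₀.trans hD
    have h2 : (m : ℝ) ≤ D := by exact_mod_cast hmD
    have h3 : (0 : ℝ) ≤ m := by positivity
    have i1 := ih (m + 1) (2 * D) (by omega) (by omega)
    have i2 := ih (m + 1) (D + 1) (by omega) (by omega)
    push_cast at i1 i2
    have hpow : ((D : ℝ) + 1) ^ (j + 1) ≤ (2 * D) ^ j * (D + 1) := by
      rw [pow_succ]
      gcongr
      linarith
    have hs := hstep m D h3 h2 (by exact_mod_cast hD)
    have hch : (j + 1 + 2).choose 2 = (j + 2).choose 2 + (j + 2) := by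
      rw [Nat.choose_succ_succ' (j + 2) 1, Nat.choose_one_right, add_comm]
    rw [show j + 1 + 2 = (j + 2) + 1 from rfl, rolleBound]
    calc (D : ℝ) * rolleBound (j + 2) (m + 1) (2 * D) +
          (m + 2) / 2 * rolleBound (j + 2) (m + 1) (D + 1)
        ≤ D * (2 ^ (j + 2).choose 2 * (2 * (D : ℝ)) ^ (j + 1) * (2 * D + (m + 1) + c)) +
          (m + 2) / 2 * (2 ^ (j + 2).choose 2 * ((2 * (D : ℝ)) ^ j * (D + 1)) *
            (D + 1 + (m + 1) + c)) := by
          gcongr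
          refine i2.trans ?_
          gcongr
      _ = 2 ^ (j + 2).choose 2 * (2 * (D : ℝ)) ^ j * (2 * D ^ 2 * (2 * D + m + 1 + c) +
            (m + 2) * (D + 1) * (D + m + c + 2) / 2) := by ring
      _ ≤ 2 ^ (j + 2).choose 2 * (2 * (D : ℝ)) ^ j * (4 * D ^ 2 * (D + m + c)) := by
          gcongr
          linarith
      _ = _ := by
          rw [hch, pow_add (2 : ℝ), mul_pow]
          ring

lemma two_mul_succ_le_two_pow_choose {k : ℕ} (hk : 2 ≤ k) : 2 * (k + 1) ≤ 3 * 2 ^ k.choose 2 := by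
  induction k, hk using Nat.le_induction with
  | base => simp
  | succ k hk ih =>
    rw [Nat.choose_succ_succ' k 1, Nat.choose_one_right, pow_add]
    have : 2 ≤ 2 ^ k :=
      (by norm_num : 2 ≤ 2 ^ 1).trans (Nat.pow_le_pow_right (by norm_num) (by omega))
    nlinarith

lemma weight_lt_of_rolleBound_le {n k : ℕ} (hn : 1 ≤ n) (hk : 2 ≤ k) {c e : ℝ}
    (h : rolleBound k n n ≤ 2 ^ k.choose 2 * (n : ℝ) ^ (k - 1) * (n + n + c))
    (hc : 3 / 2 + (2 ^ n - 1 - n) * (2 * n + c) < e * 2 ^ n * n) :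
    n * (k + 1) + (2 ^ n - 1 - n) * rolleBound k n n <
      e * 2 ^ k.choose 2 * 2 ^ n * (n : ℝ) ^ k := by
  have hw : (0 : ℝ) ≤ 2 ^ n - 1 - n := by
    have : n + 1 ≤ 2 ^ n := Nat.lt_two_pow_self
    have : (n : ℝ) + 1 ≤ 2 ^ n := by exact_mod_cast this
    linarith
  have h1 : (1 : ℝ) ≤ n := by exact_mod_cast hn
  have hpos : (0 : ℝ) < 2 ^ k.choose 2 * (n : ℝ) ^ (k - 1) := by positivity
  have hedge : (n : ℝ) * (k + 1) ≤ 2 ^ k.choose 2 * (n : ℝ) ^ (k - 1) * (3 / 2) := by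
    have h2 : 2 * ((k : ℝ) + 1) ≤ 3 * 2 ^ k.choose 2 := by
      exact_mod_cast two_mul_succ_le_two_pow_choose hk
    have h3 : (n : ℝ) ≤ n ^ (k - 1) := le_self_pow₀ h1 (by omega)
    have h4 : (0 : ℝ) ≤ n := by linarith
    calc (n : ℝ) * (k + 1) ≤ n ^ (k - 1) * (3 / 2 * 2 ^ k.choose 2) := by
          gcongr
          linarith
      _ = _ := by ring
  calc _ ≤ 2 ^ k.choose 2 * (n : ℝ) ^ (k - 1) * (3 / 2) +
        (2 ^ n - 1 - n) * (2 ^ k.choose 2 * (n : ℝ) ^ (k - 1) * (n + n + c)) := by gcongr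
    _ = 2 ^ k.choose 2 * (n : ℝ) ^ (k - 1) * (3 / 2 + (2 ^ n - 1 - n) * (2 * n + c)) := by ring
    _ < 2 ^ k.choose 2 * (n : ℝ) ^ (k - 1) * (e * 2 ^ n * n) := by gcongr
    _ = _ := by
      obtain ⟨k, rfl⟩ : ∃ l, k = l + 1 := ⟨k - 1, by omega⟩
      simp only [Nat.add_sub_cancel, pow_succ (n : ℝ)]
      ring

lemma weight_lt_of_four_le {n : ℕ} (hn : 4 ≤ n) :
    3 / 2 + ((2 : ℝ) ^ n - 1 - n) * (2 * n + 5) < 2.597 * 2 ^ n * n := by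
  rcases lt_or_ge n 9 with h | h
  · interval_cases n <;> norm_num
  · have h9 : (9 : ℝ) ≤ n := by exact_mod_cast h
    have : (0 : ℝ) ≤ 2 ^ n * (0.597 * n - 5) := by
      have : (0 : ℝ) ≤ 0.597 * n - 5 := by linarith
      positivity
    nlinarith

theorem weight_mul_rolleBound_lt {n k : ℕ} (hn : 1 ≤ n) :
    n * (k + 1) + (2 ^ n - 1 - n) * rolleBound k n n <
      (Real.exp 1 ^ 2 + 3) / 4 * 2 ^ (k * (k - 1) / 2) * 2 ^ n * (n : ℝ) ^ k := by
  have he : 2.597 ≤ (Real.exp 1 ^ 2 + 3) / 4 := by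
    nlinarith [Real.exp_one_gt_d9]
  rw [← Nat.choose_two_right]
  refine lt_of_lt_of_le ?_ (show 2.597 * 2 ^ k.choose 2 * 2 ^ n * (n : ℝ) ^ k ≤ _ by gcongr)
  have h1 : (1 : ℝ) ≤ n := by exact_mod_cast hn
  have hp : (1 : ℝ) ≤ 2 ^ n := one_le_pow₀ (by norm_num)
  rcases lt_or_ge k 2 with hk | hk
  · interval_cases k
    · simp [rolleBound]
      linarith
    · have hw : (n : ℝ) + 1 ≤ 2 ^ n := by exact_mod_cast (Nat.lt_two_pow_self : n < 2 ^ n)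
      simp only [rolleBound, Nat.choose_succ_self, pow_zero, pow_one]
      push_cast
      nlinarith [mul_nonneg (sub_nonneg.2 hw) (sub_nonneg.2 h1),
        mul_nonneg (sub_nonneg.2 hp) (sub_nonneg.2 h1)]
  · obtain ⟨j, rfl⟩ : ∃ j, k = j + 2 := ⟨k - 2, by omega⟩
    rcases lt_or_ge n 4 with h | h
    · interval_cases n
      · refine weight_lt_of_rolleBound_le (c := |rolleBound (j + 2) 1 1|) le_rfl hk ?_ (by norm_num)
        have : (1 : ℝ) ≤ 2 ^ (j + 2).choose 2 := one_le_pow₀ (by norm_num)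
        have h0 := abs_nonneg (rolleBound (j + 2) 1 1)
        have h2 := le_abs_self (rolleBound (j + 2) 1 1)
        simp only [Nat.cast_one, one_pow, mul_one]
        nlinarith
      · refine weight_lt_of_rolleBound_le (c := 14) (by norm_num) hk
          (rolleBound_le (D₀ := 2) (by norm_num) (by norm_num) (fun m D h0 hm hD => ?_)
            j 2 2 le_rfl le_rfl) (by norm_num)
        push_cast at hD
        nlinarith [mul_nonneg (mul_nonneg h0 (sub_nonneg.2 hm)) (by linarith : 0 ≤ D + 1),
          mul_nonneg h0 (sub_nonneg.2 hD), mul_nonneg h0 (sq_nonneg (D - 2)),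
          mul_nonneg (sub_nonneg.2 hD) (sub_nonneg.2 hD),
          mul_nonneg (mul_nonneg h0 (sub_nonneg.2 hD)) (h0.trans hm)]
      · refine weight_lt_of_rolleBound_le (c := 8) (by norm_num) hk
          (rolleBound_le (D₀ := 3) (by norm_num) (by norm_num) (fun m D h0 hm hD => ?_)
            j 3 3 le_rfl le_rfl) (by norm_num)
        push_cast at hD
        nlinarith [mul_nonneg (mul_nonneg h0 (sub_nonneg.2 hm)) (by linarith : 0 ≤ D + 1),
          mul_nonneg h0 (sub_nonneg.2 hD), mul_nonneg h0 (sq_nonneg (D - 3)),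
          mul_nonneg (sub_nonneg.2 hD) (sub_nonneg.2 hD),
          mul_nonneg (mul_nonneg h0 (sub_nonneg.2 hD)) (h0.trans hm)]
    · refine weight_lt_of_rolleBound_le (c := 5) hn hk
        (rolleBound_le (D₀ := 4) (by norm_num) (by norm_num) (fun m D h0 hm hD => ?_)
          j n n le_rfl h)
        (weight_lt_of_four_le h)
      push_cast at hD
      nlinarith [mul_nonneg (mul_nonneg h0 (sub_nonneg.2 hm)) (by linarith : 0 ≤ D + 1),
          mul_nonneg h0 (sub_nonneg.2 hD), mul_nonneg h0 (sq_nonneg (D - 4)),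
          mul_nonneg (sub_nonneg.2 hD) (sub_nonneg.2 hD),
          mul_nonneg (mul_nonneg h0 (sub_nonneg.2 hD)) (h0.trans hm)]

lemma exists_basis_of_affineSpan_eq_top {n : ℕ} {s : Set (Fin n → ℝ)}
    (hs : affineSpan ℝ s = ⊤) {p : Fin n → ℝ} (hp : p ∈ s) :
    ∃ B : Module.Basis (Fin n) ℝ (Fin n → ℝ), ∀ i, ∃ a ∈ s, B i = a - p := by
  have h1 : ⊤ ≤ Submodule.span ℝ ((fun a => a -ᵥ p) '' s) := by
    rw [← vectorSpan_eq_span_vsub_set_right ℝ hp, ← direction_affineSpan, hs,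
      AffineSubspace.direction_top]
  let B := Module.Basis.ofSpan h1
  have := Module.Finite.finite_basis B
  have := Fintype.ofFinite
    ↑((linearIndepOn_empty ℝ id).extend (empty_subset ((fun a => a -ᵥ p) '' s)))
  have hcard := Module.finrank_eq_card_basis B
  rw [Module.finrank_fin_fun] at hcard
  refine ⟨B.reindex (Fintype.equivFinOfCardEq hcard.symm), fun i => ?_⟩
  obtain ⟨a, ha, h⟩ := Module.Basis.ofSpan_subset h1 (mem_range_self
    ((Fintype.equivFinOfCardEq hcard.symm).symm i))
  exact ⟨a, ha, by rw [Module.Basis.reindex_apply]; exact h.symm⟩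

lemma prod_pow_eq_exp_sum {n : ℕ} {x : Fin n → ℝ} (hx : ∀ i, 0 < x i) (a : Fin n →₀ ℕ) :
    ∏ i, x i ^ a i = Real.exp (∑ i, (a i : ℝ) * Real.log (x i)) := by
  rw [Real.exp_sum]
  refine Finset.prod_congr rfl fun i _ => ?_
  rw [Real.exp_nat_mul, Real.exp_log (hx i)]

/-- In suitable monomial coordinates a fewnomial is, up to a monomial factor, an exponential sum
whose first exponents are the coordinates. -/
lemma exists_eval_eq_expSum {n k : ℕ} {f : MvPolynomial (Fin n) ℝ}
    (hcard : f.support.card = n + k + 1)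
    (hspan : affineSpan ℝ ((fun (a : Fin n →₀ ℕ) (i : Fin n) => (a i : ℝ)) '' ↑f.support) = ⊤) :
    ∃ (B : Module.Basis (Fin n) ℝ (Fin n → ℝ)) (p : Fin n → ℝ) (c₀ : ℝ) (c : Fin n → ℝ)
      (γ : Fin k → ℝ) (b : Fin k → Fin n → ℝ), ∀ x : Fin n → ℝ, (∀ i, 0 < x i) →
        MvPolynomial.eval x f = Real.exp (∑ i, p i * Real.log (x i)) *
          expSum c₀ c γ b fun j => ∑ i, B j i * Real.log (x i) := by
  classical
  obtain ⟨a₀, ha₀⟩ : f.support.Nonempty := Finset.card_pos.1 (by omega)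
  set φ := fun (a : Fin n →₀ ℕ) (i : Fin n) => (a i : ℝ)
  obtain ⟨B, hB⟩ := exists_basis_of_affineSpan_eq_top hspan (mem_image_of_mem φ ha₀)
  have hB' : ∀ i, ∃ a ∈ f.support, B i = φ a - φ a₀ := fun i => by
    obtain ⟨_, ⟨a, ha, rfl⟩, h⟩ := hB i
    exact ⟨a, ha, h⟩
  choose e he hBe using hB'
  have hinj : Function.Injective e := fun i j h => B.injective (by rw [hBe, hBe, h])
  have hne : a₀ ∉ Finset.univ.image e := fun h => by
    obtain ⟨i, -, hi⟩ := Finset.mem_image.1 h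
    exact B.ne_zero i (by rw [hBe, hi, sub_self])
  set T := insert a₀ (Finset.univ.image e)
  have hT : T ⊆ f.support := Finset.insert_subset ha₀ fun a ha => by
    obtain ⟨i, -, rfl⟩ := Finset.mem_image.1 ha
    exact he i
  have hTc : (f.support \ T).card = k := by
    rw [Finset.card_sdiff_of_subset hT, hcard, Finset.card_insert_of_notMem hne,
      Finset.card_image_of_injective _ hinj, Finset.card_univ, Fintype.card_fin]
    omega
  let d : Fin k ≃ ↥(f.support \ T) := (Finset.equivFinOfCardEq hTc).symm
  refine ⟨B, φ a₀, f.coeff a₀, fun i => f.coeff (e i), fun l => f.coeff (d l),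
    fun l => B.repr (φ (d l) - φ a₀), fun x hx => ?_⟩
  set w := fun i => Real.log (x i)
  have hmon : ∀ a : Fin n →₀ ℕ, ∏ i, x i ^ a i = Real.exp (∑ i, φ a₀ i * w i) *
      Real.exp (∑ i, (φ a - φ a₀) i * w i) := by
    intro a
    rw [prod_pow_eq_exp_sum hx, ← Real.exp_add, ← Finset.sum_add_distrib]
    congr 1
    exact Finset.sum_congr rfl fun i _ => by simp only [Pi.sub_apply, φ, w]; ring
  have hlin : ∀ v : Fin n → ℝ, ∑ j, B.repr v j * ∑ i, B j i * w i = ∑ i, v i * w i := by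
    intro v
    simp only [Finset.mul_sum]
    rw [Finset.sum_comm]
    refine Finset.sum_congr rfl fun i _ => ?_
    conv_rhs => rw [← B.sum_repr v]
    simp [Finset.sum_apply, Finset.sum_mul, mul_assoc]
  rw [MvPolynomial.eval_eq', ← Finset.sum_sdiff hT, Finset.sum_insert hne,
    Finset.sum_image fun i _ j _ h => hinj h, ← Finset.sum_coe_sort, ← d.sum_comp]
  change _ = Real.exp (∑ i, φ a₀ i * w i) * expSum _ _ _ _ fun j => ∑ i, B j i * w i
  simp only [hmon, expSum, hlin]
  simp only [hBe, sub_self, Pi.zero_apply, zero_mul, Finset.sum_const_zero, Real.exp_zero]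
  rw [mul_add, mul_add, Finset.mul_sum, Finset.mul_sum]
  simp only [mul_left_comm (Real.exp _)]
  ring

lemma fderiv_expSum_eq_zero {n k : ℕ} {c₀ : ℝ} {c : Fin n → ℝ} {γ : Fin k → ℝ}
    {b : Fin k → Fin n → ℝ} {u : Fin n → ℝ} (h : ∀ i, expSumDeriv c γ b i u = 0) :
    fderiv ℝ (expSum c₀ c γ b) u = 0 := by
  refine ContinuousLinearMap.coe_injective (LinearMap.pi_ext' fun i => LinearMap.ext_ring ?_)
  simpa using (fderiv_expSum_single c₀ c γ b u i).trans (h i)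

/-- A set with a bound for the size of its finite subsets is finite. -/
lemma finite_and_ncard_le {α : Type*} {s : Set α} {r : ℝ}
    (h : ∀ T : Finset α, ↑T ⊆ s → (T.card : ℝ) ≤ r) : s.Finite ∧ (s.ncard : ℝ) ≤ r := by
  have hs : s.Finite := by
    by_contra hinf
    obtain ⟨T, hT, hc⟩ := Set.Infinite.exists_subset_card_eq hinf (⌊r⌋₊ + 1)
    have := h T hT
    rw [hc] at this
    push_cast at this
    linarith [Nat.lt_floor_add_one r]
  refine ⟨hs, ?_⟩
  rw [Set.ncard_eq_toFinset_card s hs]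
  exact h _ (by simp)

lemma connectedComponentIn_eq_of_leftInvOn {α β : Type*} [TopologicalSpace α] [TopologicalSpace β]
    {X : Set α} {Y : Set β} {F : α → β} {G : β → α} (hF : MapsTo F X Y) (hG : MapsTo G Y X)
    (hGc : ContinuousOn G Y) (hGF : LeftInvOn G F X) {p q : α} (hp : p ∈ X) (hq : q ∈ X)
    (h : connectedComponentIn Y (F p) = connectedComponentIn Y (F q)) :
    connectedComponentIn X p = connectedComponentIn X q := by
  have hsub := connectedComponentIn_subset Y (F p)
  have hpc : IsPreconnected (G '' connectedComponentIn Y (F p)) :=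
    isPreconnected_connectedComponentIn.image _ (hGc.mono hsub)
  have hpm : p ∈ G '' connectedComponentIn Y (F p) :=
    ⟨F p, mem_connectedComponentIn (hF hp), hGF hp⟩
  have hqm : q ∈ G '' connectedComponentIn Y (F p) :=
    ⟨F q, h ▸ mem_connectedComponentIn (hF hq), hGF hq⟩
  exact connectedComponentIn_eq (hpc.subset_connectedComponentIn hpm
    (hG.mono_left hsub).image_subset hqm)

section Coordinates

variable {n k : ℕ} (B : Module.Basis (Fin n) ℝ (Fin n → ℝ))

/-- The linear map with the vectors of a basis as rows, as an equivalence. -/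
noncomputable def rowEquiv : (Fin n → ℝ) ≃L[ℝ] (Fin n → ℝ) :=
  (LinearEquiv.ofInjectiveEndo (Matrix.toLin' (Matrix.of fun j i => B j i)) (by
    rw [← LinearMap.ker_eq_bot, LinearMap.ker_eq_bot']
    intro w hw
    have h : ∀ v : Fin n → ℝ, ∑ i, v i * w i = 0 := fun v => by
      rw [← B.sum_repr v]
      simp only [Finset.sum_apply, Pi.smul_apply, smul_eq_mul, Finset.sum_mul, mul_assoc]
      rw [Finset.sum_comm]
      refine Finset.sum_eq_zero fun j _ => ?_
      rw [← Finset.mul_sum]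
      have := congrFun hw j
      simp only [Matrix.toLin'_apply, Matrix.mulVec, dotProduct, Matrix.of_apply,
        Pi.zero_apply] at this
      rw [this, mul_zero]
    funext i
    simpa [Pi.single_apply] using h (Pi.single i 1))).toContinuousLinearEquiv

lemma rowEquiv_apply (w : Fin n → ℝ) (j : Fin n) : rowEquiv B w j = ∑ i, B j i * w i := by
  simp [rowEquiv, Matrix.mulVec, dotProduct]

end Coordinates

lemma exists_expSumDeriv_ne_zero {n k : ℕ} {f : MvPolynomial (Fin n) ℝ}
    {L : (Fin n → ℝ) →L[ℝ] Fin n → ℝ} {a : Fin n → ℝ} {c₀ : ℝ} {c : Fin n → ℝ}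
    {γ : Fin k → ℝ} {b : Fin k → Fin n → ℝ}
    (hf : ∀ x : Fin n → ℝ, (∀ i, 0 < x i) → MvPolynomial.eval x f =
      Real.exp (∑ i, a i * Real.log (x i)) * expSum c₀ c γ b (L fun i => Real.log (x i)))
    {x : Fin n → ℝ} (hx : ∀ i, 0 < x i) (h0 : MvPolynomial.eval x f = 0)
    (h1 : ∃ i, MvPolynomial.eval x (MvPolynomial.pderiv i f) ≠ 0) :
    ∃ i, expSumDeriv c γ b i (L fun i => Real.log (x i)) ≠ 0 := by
  by_contra! h
  obtain ⟨i, hi⟩ := h1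
  have hlog : DifferentiableAt ℝ (fun (x : Fin n → ℝ) i => Real.log (x i)) x :=
    differentiableAt_pi.2 fun i => by fun_prop (disch := exact (hx _).ne')
  have hexp : DifferentiableAt ℝ
      (fun x : Fin n → ℝ => Real.exp (∑ i, a i * Real.log (x i))) x := by
    fun_prop (disch := exact (hx _).ne')
  have hsum : HasFDerivAt (fun x : Fin n → ℝ => expSum c₀ c γ b (L fun i => Real.log (x i)))
      (0 : (Fin n → ℝ) →L[ℝ] ℝ) x := by
    have h2 := ((contDiff_expSum c₀ c γ b (m := 1)).differentiable one_ne_zero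
      (L fun i => Real.log (x i))).hasFDerivAt
    rw [fderiv_expSum_eq_zero h] at h2
    have h3 := h2.comp x (L.hasFDerivAt.comp x hlog.hasFDerivAt)
    rwa [ContinuousLinearMap.zero_comp] at h3
  have hzero : expSum c₀ c γ b (L fun i => Real.log (x i)) = 0 := by
    rw [hf x hx] at h0
    exact (mul_eq_zero.1 h0).resolve_left (Real.exp_ne_zero _)
  have hprod := hexp.hasFDerivAt.mul hsum
  rw [hzero, smul_zero, zero_smul, add_zero] at hprod
  have hev : (fun x => MvPolynomial.eval x f) =ᶠ[𝓝 x] fun x =>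
      Real.exp (∑ i, a i * Real.log (x i)) * expSum c₀ c γ b (L fun i => Real.log (x i)) := by
    have : ∀ᶠ y in 𝓝 x, ∀ i, 0 < y i := by
      rw [eventually_all]
      exact fun i => (continuous_apply i).continuousAt.eventually (lt_mem_nhds (hx i))
    filter_upwards [this] with y hy using hf y hy
  have := (MvPolynomial.hasFDerivAt_eval f x).unique (hprod.congr_of_eventuallyEq hev)
  have := congrArg (fun A => A (Pi.single i 1)) this
  refine hi ?_
  simpa [sum_apply, Pi.single_apply] using this

end Fewnomials

/-- If `f` is a real polynomial in `n` variables with exactly `n + k + 1`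
monomials whose exponent vectors affinely span `ℝ^n` and one of whose monomials has all
exponents nonzero, and if its zero set in the positive orthant is a smooth hypersurface,
then that hypersurface has fewer than `((e² + 3)/4) · 2^(k(k−1)/2) · 2^n · n^k` connected
components. -/
theorem fewnomial_hypersurface_bound_interior_monomial (n k : ℕ) (hn : 1 ≤ n)
    (f : MvPolynomial (Fin n) ℝ)
    (hcard : f.support.card = n + k + 1)
    (hspan : affineSpan ℝ ((fun (a : Fin n →₀ ℕ) (i : Fin n) => (a i : ℝ)) '' ↑f.support) = ⊤)
    (hmono : ∃ a ∈ f.support, ∀ i, a i ≠ 0)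
    (X : Set (Fin n → ℝ))
    (hX : X = {x | (∀ i, 0 < x i) ∧ MvPolynomial.eval x f = 0})
    (hsmooth : ∀ x ∈ X, ∃ i, MvPolynomial.eval x (MvPolynomial.pderiv i f) ≠ 0) :
    (components X).Finite ∧
    ((components X).ncard : ℝ) <
      (Real.exp 1 ^ 2 + 3) / 4 * 2 ^ (k * (k - 1) / 2) * 2 ^ n * (n : ℝ) ^ k := by
  classical
  obtain ⟨B, a, c₀, c, γ, b, hf⟩ := exists_eval_eq_expSum hcard hspan
  simp only [← rowEquiv_apply B] at hf
  have hpos : ∀ x ∈ X, ∀ i, 0 < x i := fun x hx => (hX ▸ hx).1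
  have heval : ∀ x ∈ X, MvPolynomial.eval x f = 0 := fun x hx => (hX ▸ hx).2
  let F : (Fin n → ℝ) → Fin n → ℝ := fun x => rowEquiv B fun i => Real.log (x i)
  let G : (Fin n → ℝ) → Fin n → ℝ := fun u i => Real.exp ((rowEquiv B).symm u i)
  have hFG : ∀ u, F (G u) = u := fun u => by simp [F, G]
  have hGF : Set.LeftInvOn G F X := fun x hx => funext fun i => by
    simp [F, G, Real.exp_log (hpos x hx i)]
  have hF : Set.MapsTo F X {u | expSum c₀ c γ b u = 0} := fun x hx => by
    have := hf x (hpos x hx)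
    rw [heval x hx] at this
    exact (mul_eq_zero.1 this.symm).resolve_left (Real.exp_ne_zero _)
  have hG : Set.MapsTo G {u | expSum c₀ c γ b u = 0} X := fun u hu => by
    have hGpos : ∀ i, 0 < G u i := fun i => Real.exp_pos _
    rw [hX]
    refine ⟨hGpos, ?_⟩
    rw [hf _ hGpos, show expSum c₀ c γ b _ = 0 from (congrArg _ (hFG u)).trans hu, mul_zero]
  have hGc : Continuous G := continuous_pi fun i =>
    Real.continuous_exp.comp ((continuous_apply i).comp (rowEquiv B).symm.continuous)
  have hFd : ∀ x ∈ X, ∃ i, expSumDeriv c γ b i (F x) ≠ 0 := fun x hx =>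
    exists_expSumDeriv_ne_zero (L := (rowEquiv B : (Fin n → ℝ) →L[ℝ] Fin n → ℝ)) hf (hpos x hx)
      (heval x hx) (hsmooth x hx)
  clear_value F G
  have hbound := finite_and_ncard_le (s := components X)
    (r := n * (k + 1) + (2 ^ n - 1 - n) * rolleBound k n n) fun T hT => by
      have hT' : ∀ C ∈ T, ∃ x ∈ X, C = connectedComponentIn X x := fun C hC => hT hC
      choose! r hrX hr using hT'
      have hinj : Set.InjOn (fun C => F (r C)) T := fun C hC D hD h => by
        rw [hr C hC, hr D hD, hGF.injOn (hrX C hC) (hrX D hD) h]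
      rw [← Finset.card_image_of_injOn hinj]
      refine card_le_of_connectedComponentIn_ne (c₀ := c₀) (c := c) (γ := γ) (b := b) _
        (fun q hq => ?_) fun p hp q hq hpq h => hpq ?_
      · obtain ⟨C, hC, rfl⟩ := Finset.mem_image.1 hq
        exact ⟨hF (hrX C hC), hFd _ (hrX C hC)⟩
      · obtain ⟨C, hC, rfl⟩ := Finset.mem_image.1 hp
        obtain ⟨D, hD, rfl⟩ := Finset.mem_image.1 hq
        have := connectedComponentIn_eq_of_leftInvOn hF hG hGc.continuousOn hGF
          (hrX C hC) (hrX D hD) h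
        rw [← hr C hC, ← hr D hD] at this
        rw [this]
  exact ⟨hbound.1, hbound.2.trans_lt (weight_mul_rolleBound_lt hn)⟩
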